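/- arXiv:1007.0353 — 2 statements merged into one kernel-verified Lean document; each statement's English description precedes it below -/
import Mathlib

section
/- For positive integers H and squarefree q = d² with 8 ∤ q (i.e., d squarefree), T(H, q) = H²·λ(q)/q² + O_ε(H^ε(H·q^{−1/2} + q^{1/2} + H^{−1}q)), where λ(q) counts solutions 1 ≤ x, y ≤ q of x² + y² + 1 ≡ 0 (mod q). -/
open Finset

/-- λ(q) = number of pairs 1 ≤ x, y ≤ q with x² + y² + 1 ≡ 0 (mod q). -/
def lamCount (q : ℕ) : ℕ :=
  ((Finset.Icc 1 q ×ˢ Finset.Icc 1 q).filter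
    (fun p : ℕ × ℕ => (q : ℤ) ∣ ((p.1 : ℤ)^2 + (p.2 : ℤ)^2 + 1))).card

/-- T(H, q) = number of pairs of positive integers x, y ≤ H with x² + y² + 1 ≡ 0 (mod q). -/
def Tcount (H q : ℕ) : ℕ :=
  ((Finset.Icc 1 H ×ˢ Finset.Icc 1 H).filter
    (fun p : ℕ × ℕ => (q : ℤ) ∣ ((p.1 : ℤ)^2 + (p.2 : ℤ)^2 + 1))).card

/-- Points of the affine circle mod `n^2` in a box of side `n^2`, proportional to `(a,b)` mod `n`. -/
def circSet (a b n : ℕ) : Finset (ℕ × ℕ) :=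
  ((Finset.range (n^2) ×ˢ Finset.range (n^2)).filter
    (fun p : ℕ × ℕ => ((n:ℤ)^2 ∣ ((p.1 : ℤ)^2 + (p.2 : ℤ)^2 + 1)) ∧
      (n:ℤ) ∣ (a:ℤ) * p.2 - b * p.1))

lemma mem_circSet {a b n : ℕ} {p : ℕ × ℕ} : p ∈ circSet a b n ↔
    (p.1 < n^2 ∧ p.2 < n^2) ∧ ((n:ℤ)^2 ∣ ((p.1 : ℤ)^2 + (p.2 : ℤ)^2 + 1)) ∧
      (n:ℤ) ∣ (a:ℤ) * p.2 - b * p.1 := by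
  simp [circSet]

lemma circSet_reduce {a b m n : ℕ} (hm : m ≠ 0) (h : m ∣ n) {p : ℕ × ℕ} (hp : p ∈ circSet a b n) :
    (p.1 % m^2, p.2 % m^2) ∈ circSet a b m := by
  rw [mem_circSet] at hp ⊢
  obtain ⟨-, h1, h2⟩ := hp
  have hpos : 0 < m^2 := by positivity
  have hmn : (m:ℤ) ∣ n := by exact_mod_cast h
  have hx : ((p.1 % m^2 : ℕ) : ℤ) = p.1 - (m:ℤ)^2 * ((p.1:ℤ) / (m:ℤ)^2) := by
    push_cast; rw [Int.emod_def]
  have hy : ((p.2 % m^2 : ℕ) : ℤ) = p.2 - (m:ℤ)^2 * ((p.2:ℤ) / (m:ℤ)^2) := by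
    push_cast; rw [Int.emod_def]
  refine ⟨⟨Nat.mod_lt _ hpos, Nat.mod_lt _ hpos⟩, ?_, ?_⟩
  · dsimp only
    rw [hx, hy]
    obtain ⟨k, hk⟩ := (pow_dvd_pow_of_dvd hmn 2).trans h1
    generalize (p.1:ℤ) / (m:ℤ)^2 = u at *
    generalize (p.2:ℤ) / (m:ℤ)^2 = v at *
    refine ⟨k - 2 * p.1 * u - 2 * p.2 * v + m^2*u^2 + m^2*v^2, ?_⟩
    linear_combination hk
  · dsimp only
    rw [hx, hy]
    obtain ⟨k, hk⟩ := hmn.trans h2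
    generalize (p.1:ℤ) / (m:ℤ)^2 = u at *
    generalize (p.2:ℤ) / (m:ℤ)^2 = v at *
    refine ⟨k - a * m * v + b * m * u, ?_⟩
    linear_combination hk

lemma circSet_mul (a b : ℕ) {m n : ℕ} (hm : m ≠ 0) (hn : n ≠ 0) (h : m.Coprime n) :
    (circSet a b (m*n)).card ≤ (circSet a b m).card * (circSet a b n).card := by
  rw [← Finset.card_product]
  apply Finset.card_le_card_of_injOn
    (fun p => ((p.1 % m^2, p.2 % m^2), (p.1 % n^2, p.2 % n^2)))
  · intro p hp
    have hp : p ∈ circSet a b (m*n) := hp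
    simp only [Finset.coe_product, Set.mem_prod, Finset.mem_coe]
    exact ⟨circSet_reduce hm (dvd_mul_right _ _) hp, circSet_reduce hn (dvd_mul_left _ _) hp⟩
  · intro p hp p' hp' he
    have hp : p ∈ circSet a b (m*n) := hp
    have hp' : p' ∈ circSet a b (m*n) := hp'
    rw [mem_circSet] at hp hp'
    simp only [Prod.mk.injEq] at he
    obtain ⟨⟨e1, e2⟩, e3, e4⟩ := he
    have hc : (m^2).Coprime (n^2) := Nat.Coprime.pow 2 2 h
    have k1 : p.1 ≡ p'.1 [MOD (m*n)^2] := by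
      rw [mul_pow]; exact (Nat.modEq_and_modEq_iff_modEq_mul hc).1 ⟨e1, e3⟩
    have k2 : p.2 ≡ p'.2 [MOD (m*n)^2] := by
      rw [mul_pow]; exact (Nat.modEq_and_modEq_iff_modEq_mul hc).1 ⟨e2, e4⟩
    exact Prod.ext (Nat.ModEq.eq_of_lt_of_lt k1 hp.1.1 hp'.1.1)
      (Nat.ModEq.eq_of_lt_of_lt k2 hp.1.2 hp'.1.2)

/-- uniqueness of square root lifts -/
lemma lift_unique {p : ℕ} (hp : p.Prime) (h2 : p ≠ 2) {x y y' : ℕ} (hy : y < p^2) (hy' : y' < p^2)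
    (hm : y % p = y' % p) (hne : ¬ p ∣ y)
    (h : (p:ℤ)^2 ∣ (x:ℤ)^2 + y^2 + 1) (h' : (p:ℤ)^2 ∣ (x:ℤ)^2 + y'^2 + 1) : y = y' := by
  have h3 : (p:ℤ)^2 ∣ ((y:ℤ) + y') * ((y:ℤ) - y') := by
    have := dvd_sub h h'
    have e : ((y:ℤ) + y') * ((y:ℤ) - y') = (x:ℤ)^2 + y^2 + 1 - ((x:ℤ)^2 + y'^2 + 1) := by ring
    rw [e]; exact this
  have hpp : Prime (p:ℤ) := Nat.prime_iff_prime_int.1 hp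
  have hmz : (p:ℤ) ∣ (y:ℤ) - y' := by
    have : y' ≡ y [MOD p] := hm.symm
    exact this.dvd
  have hn : ¬ (p:ℤ) ∣ (y:ℤ) + y' := by
    intro hd
    have : (p:ℤ) ∣ 2 * (y:ℤ) := by
      have := dvd_add hd hmz
      have e : 2 * (y:ℤ) = (y:ℤ) + y' + (y - y') := by ring
      rw [e]; exact this
    rcases hpp.dvd_or_dvd this with h | h
    · have : p ∣ 2 := by exact_mod_cast h
      exact h2 ((Nat.prime_dvd_prime_iff_eq hp Nat.prime_two).1 this)
    · exact hne (by exact_mod_cast h)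
  have hcop : IsCoprime ((p:ℤ)^2) ((y:ℤ) + y') :=
    IsCoprime.pow_left ((hpp.coprime_iff_not_dvd).2 hn)
  have hd := hcop.dvd_of_dvd_mul_left h3
  have : y' ≡ y [MOD p^2] := by
    rw [Nat.modEq_iff_dvd]; exact_mod_cast hd
  exact (Nat.ModEq.eq_of_lt_of_lt this hy' hy).symm

/-- number of square roots in a field is at most two -/
lemma card_sqrt_le {F : Type*} [Field F] [Fintype F] [DecidableEq F] (c : F) :
    ((Finset.univ : Finset F).filter (fun x => x^2 = c)).card ≤ 2 := by
  by_cases h : ∃ r : F, r^2 = c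
  · obtain ⟨r, hr⟩ := h
    calc _ ≤ ({r, -r} : Finset F).card := by
          apply Finset.card_le_card
          intro x hx
          simp only [Finset.mem_filter, Finset.mem_univ, true_and] at hx
          rw [← hr] at hx
          simpa using sq_eq_sq_iff_eq_or_eq_neg.1 hx
      _ ≤ 2 := Finset.card_le_two
  · push Not at h
    rw [Finset.filter_false_of_mem (fun x _ => h x)]; simp

/-- points mod p -/
def circP (p : ℕ) [NeZero p] (a b : ZMod p) : Finset (ZMod p × ZMod p) :=
  Finset.univ.filter (fun z => z.1^2 + z.2^2 + 1 = 0 ∧ a * z.2 - b * z.1 = 0)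

lemma card_circP_all (p : ℕ) [Fact p.Prime] (a b : ZMod p) : (circP p a b).card ≤ 2 * p := by
  have := Finset.card_le_mul_card_image_of_maps_to (f := Prod.fst) (s := circP p a b)
    (t := Finset.univ) (by simp) 2 (by
      intro x _
      refine le_trans ?_ (card_sqrt_le (-1 - x^2))
      apply Finset.card_le_card_of_injOn Prod.snd
      · intro z hz
        simp only [circP, Finset.coe_filter, Finset.mem_filter, Finset.mem_univ, true_and,
          Set.mem_ofPred_eq] at hz ⊢
        obtain ⟨⟨h1, -⟩, rfl⟩ := hz
        linear_combination h1
      · intro z hz z' hz' h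
        simp only [Finset.coe_filter, Set.mem_ofPred_eq] at hz hz'
        exact Prod.ext (hz.2.trans hz'.2.symm) h)
  simpa [ZMod.card] using this

lemma card_circP_a (p : ℕ) [Fact p.Prime] (a b : ZMod p) (ha : a ≠ 0) :
    (circP p a b).card ≤ 2 := by
  refine le_trans ?_ (card_sqrt_le (-a^2 / (a^2+b^2)))
  have key : ∀ z ∈ circP p a b, z.2 = b * z.1 / a ∧ z.1^2 * (a^2+b^2) = - a^2 := by
    intro z hz
    simp only [circP, Finset.mem_filter, Finset.mem_univ, true_and] at hz
    refine ⟨?_, ?_⟩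
    · field_simp; linear_combination hz.2
    · linear_combination a^2 * hz.1 - (a * z.2 + b * z.1) * hz.2
  apply Finset.card_le_card_of_injOn Prod.fst
  · intro z hz
    have := (key z hz).2
    have hne : a^2+b^2 ≠ 0 := by
      intro h; rw [h] at this
      have : a^2 = 0 := by simpa using this
      exact ha (by simpa using this)
    simp only [Finset.coe_filter, Finset.mem_univ, true_and, Set.mem_ofPred_eq]
    rw [eq_div_iff hne, this]
  · intro z hz z' hz' h
    refine Prod.ext h ?_
    rw [(key z hz).1, (key z' hz').1, h]

lemma card_circP_b (p : ℕ) [Fact p.Prime] (a b : ZMod p) (hb : b ≠ 0) :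
    (circP p a b).card ≤ 2 := by
  refine le_trans ?_ (card_circP_a p b a hb)
  apply Finset.card_le_card_of_injOn Prod.swap
  · intro z hz
    simp only [circP, Finset.coe_filter, Finset.mem_univ, true_and, Set.mem_ofPred_eq,
      Prod.fst_swap, Prod.snd_swap] at hz ⊢
    exact ⟨by linear_combination hz.1, by linear_combination -hz.2⟩
  · exact Prod.swap_injective.injOn

lemma card_circP (p : ℕ) [Fact p.Prime] (a b : ℕ) :
    (circP p (a : ZMod p) (b : ZMod p)).card ≤ 2 * Nat.gcd (Nat.gcd a b) p := by
  have hp : p.Prime := Fact.out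
  by_cases ha : (a : ZMod p) = 0
  · by_cases hb : (b : ZMod p) = 0
    · have h1 := (ZMod.natCast_eq_zero_iff _ _).1 ha
      have h2 := (ZMod.natCast_eq_zero_iff _ _).1 hb
      rw [Nat.gcd_eq_right (Nat.dvd_gcd h1 h2)]
      exact card_circP_all _ _ _
    · have := card_circP_b p a b hb
      have : 0 < Nat.gcd (Nat.gcd a b) p := Nat.gcd_pos_of_pos_right _ hp.pos
      omega
  · have := card_circP_a p a b ha
    have : 0 < Nat.gcd (Nat.gcd a b) p := Nat.gcd_pos_of_pos_right _ hp.pos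
    omega

lemma card_circSet_prime {p : ℕ} (hp : p.Prime) (a b : ℕ) :
    (circSet a b p).card ≤ 4 * p * Nat.gcd (Nat.gcd a b) p := by
  by_cases h2 : p = 2
  · have : circSet a b p = ∅ := by
      rw [Finset.eq_empty_iff_forall_notMem]
      intro z hz
      rw [mem_circSet] at hz
      obtain ⟨-, h, -⟩ := hz
      subst h2
      generalize (z.1:ℤ) = x at h
      generalize (z.2:ℤ) = y at h
      norm_num at h
      rcases Int.even_or_odd' x with ⟨u, rfl | rfl⟩ <;> rcases Int.even_or_odd' y with ⟨v, rfl | rfl⟩ <;>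
      · ring_nf at h
        omega
    simp [this]
  have : Fact p.Prime := ⟨hp⟩
  have h1 := Finset.card_le_mul_card_image_of_maps_to (s := circSet a b p)
    (t := circP p (a : ZMod p) (b : ZMod p))
    (f := fun z => ((z.1 : ZMod p), (z.2 : ZMod p))) (by
      intro z hz
      rw [mem_circSet] at hz
      obtain ⟨-, h, h'⟩ := hz
      simp only [circP, Finset.mem_filter, Finset.mem_univ, true_and]
      have k1 := (ZMod.intCast_zmod_eq_zero_iff_dvd _ p).2 ((dvd_pow_self _ two_ne_zero).trans h)
      have k2 := (ZMod.intCast_zmod_eq_zero_iff_dvd _ p).2 h'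
      push_cast at k1 k2
      exact ⟨k1, k2⟩) p (by
      intro w hw
      have hpp : 0 < p := hp.pos
      have hmod : ∀ (u v : ℕ), (u : ZMod p) = v → u % p = v % p := fun u v h =>
        (ZMod.natCast_eq_natCast_iff _ _ _).1 h
      have hdiv : ∀ u v : ℕ, u % p = v % p → u / p = v / p → u = v := by
        intro u v h h'
        rw [← Nat.div_add_mod u p, ← Nat.div_add_mod v p, h, h']
      by_cases hw2 : w.2 = 0
      · have hw1 : w.1 ≠ 0 := by
          intro h
          simp [circP, h, hw2] at hw
        refine le_of_le_of_eq ?_ (Finset.card_range p)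
        apply Finset.card_le_card_of_injOn (fun z => z.2 / p)
        · intro z hz
          simp only [Finset.coe_filter, Set.mem_ofPred_eq, mem_circSet] at hz
          simp only [Finset.coe_range, Set.mem_Iio]
          rw [Nat.div_lt_iff_lt_mul hpp, ← sq]
          exact hz.1.1.2
        · intro z hz z' hz' he
          simp only [Finset.coe_filter, Set.mem_ofPred_eq, mem_circSet] at hz hz'
          obtain ⟨⟨⟨b1, b2⟩, c1, -⟩, rfl⟩ := hz
          obtain ⟨⟨⟨b1', b2'⟩, c1', -⟩, hz'⟩ := hz'
          rw [Prod.mk.injEq] at hz'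
          have e2 : z.2 = z'.2 := hdiv _ _ (hmod _ _ hz'.2.symm) he
          refine Prod.ext (lift_unique hp h2 (x := z.2) b1 b1' (hmod _ _ hz'.1.symm) ?_ ?_ ?_) e2
          · intro h; exact hw1 ((ZMod.natCast_eq_zero_iff _ _).2 h)
          · convert c1 using 1; ring
          · rw [e2]; convert c1' using 1; ring
      · refine le_of_le_of_eq ?_ (Finset.card_range p)
        apply Finset.card_le_card_of_injOn (fun z => z.1 / p)
        · intro z hz
          simp only [Finset.coe_filter, Set.mem_ofPred_eq, mem_circSet] at hz
          simp only [Finset.coe_range, Set.mem_Iio]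
          rw [Nat.div_lt_iff_lt_mul hpp, ← sq]
          exact hz.1.1.1
        · intro z hz z' hz' he
          simp only [Finset.coe_filter, Set.mem_ofPred_eq, mem_circSet] at hz hz'
          obtain ⟨⟨⟨b1, b2⟩, c1, -⟩, rfl⟩ := hz
          obtain ⟨⟨⟨b1', b2'⟩, c1', -⟩, hz'⟩ := hz'
          rw [Prod.mk.injEq] at hz'
          have e1 : z.1 = z'.1 := hdiv _ _ (hmod _ _ hz'.1.symm) he
          refine Prod.ext e1 (lift_unique hp h2 (x := z.1) b2 b2' (hmod _ _ hz'.2.symm) ?_ c1 ?_)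
          · intro h; exact hw2 ((ZMod.natCast_eq_zero_iff _ _).2 h)
          · rw [e1]; exact c1')
  have h3 := card_circP p a b
  calc _ ≤ p * _ := h1
    _ ≤ p * (2 * Nat.gcd (Nat.gcd a b) p) := Nat.mul_le_mul_left _ h3
    _ ≤ _ := by nlinarith [Nat.zero_le (p * Nat.gcd (Nat.gcd a b) p)]

lemma card_circSet (a b : ℕ) (d : ℕ) : Squarefree d →
    (circSet a b d).card ≤ d.divisors.card^2 * d * Nat.gcd (Nat.gcd a b) d := by
  induction d using Nat.recOnPrimeCoprime with
  | zero => intro h; simp at h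
  | prime_pow p n hp =>
    intro h
    rcases Nat.eq_zero_or_pos n with rfl | hn
    · simp only [pow_zero, Nat.divisors_one, Finset.card_singleton, Nat.gcd_one_right]
      have : (circSet a b 1) ⊆ {(0,0)} := by
        intro z hz; rw [mem_circSet] at hz
        simp at hz; simp [Prod.ext_iff, hz]
      simpa using Finset.card_le_card this
    · have : n = 1 := by
        rcases Nat.lt_or_ge 1 n with h1 | h1
        · exfalso
          have : p * p ∣ p^n := by rw [← sq]; exact pow_dvd_pow _ h1
          exact hp.one_lt.ne' (Nat.isUnit_iff.1 (h p this))
        · omega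
      subst this
      rw [pow_one]
      refine (card_circSet_prime hp a b).trans ?_
      rw [hp.divisors, Finset.card_pair hp.one_lt.ne]
      norm_num
  | coprime m n hm hn hmn ihm ihn =>
    intro h
    have h1 := ihm (h.of_mul_left)
    have h2 := ihn (h.of_mul_right)
    refine (circSet_mul a b (by omega) (by omega) hmn).trans ?_
    rw [hmn.card_divisors_mul, Nat.Coprime.gcd_mul _ hmn]
    calc _ ≤ _ := Nat.mul_le_mul h1 h2
      _ = _ := by ring
/-- Circle points modulo `q`. -/
def circA (q : ℕ) [NeZero q] : Finset (ZMod q × ZMod q) :=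
  Finset.univ.filter (fun z => z.1^2 + z.2^2 + 1 = 0)

/-- The number of `n ≤ H` in a residue class. -/
def resCount (q H : ℕ) (x : ZMod q) : ℕ := ((Finset.Icc 1 H).filter (fun n : ℕ => (n : ZMod q) = x)).card

lemma Tcount_eq (q H : ℕ) [NeZero q] :
    Tcount H q = ∑ z ∈ circA q, resCount q H z.1 * resCount q H z.2 := by
  unfold Tcount
  rw [Finset.card_eq_sum_card_fiberwise (t := circA q)
    (f := fun p : ℕ × ℕ => ((p.1 : ZMod q), (p.2 : ZMod q)))]
  · apply Finset.sum_congr rfl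
    intro z hz
    rw [resCount, resCount, ← Finset.card_product]
    congr 1
    ext p
    simp only [Finset.mem_filter, Finset.mem_product, Prod.ext_iff]
    constructor
    · rintro ⟨⟨⟨h1, h2⟩, -⟩, h3, h4⟩
      exact ⟨⟨h1, h3⟩, h2, h4⟩
    · rintro ⟨⟨h1, h3⟩, h2, h4⟩
      refine ⟨⟨⟨h1, h2⟩, ?_⟩, h3, h4⟩
      rw [← ZMod.intCast_zmod_eq_zero_iff_dvd]
      push_cast
      rw [h3, h4]
      simpa [circA] using hz
  · intro p hp
    simp only [Finset.coe_filter, Set.mem_ofPred_eq] at hp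
    have := (ZMod.intCast_zmod_eq_zero_iff_dvd _ q).2 hp.2
    push_cast at this
    simpa [circA] using this

lemma resCount_self (q : ℕ) [NeZero q] (x : ZMod q) : resCount q q x = 1 := by
  have hq : 0 < q := Nat.pos_of_neZero q
  unfold resCount
  rw [Finset.card_eq_one]
  refine ⟨if x.val = 0 then q else x.val, ?_⟩
  have hv := ZMod.val_lt x
  ext n
  simp only [Finset.mem_filter, Finset.mem_Icc, Finset.mem_singleton]
  constructor
  · rintro ⟨⟨h1, h2⟩, rfl⟩
    rw [ZMod.val_natCast]
    rcases Nat.lt_or_ge n q with h | h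
    · rw [Nat.mod_eq_of_lt h, if_neg (by omega)]
    · have : n = q := le_antisymm h2 h
      subst this; simp
  · rintro rfl
    split_ifs with h
    · refine ⟨⟨hq, le_rfl⟩, ?_⟩
      rw [ZMod.natCast_self, eq_comm]
      exact (ZMod.val_eq_zero x).1 h
    · exact ⟨⟨by omega, by omega⟩, by simp⟩

lemma lamCount_eq (q : ℕ) [NeZero q] : lamCount q = (circA q).card := by
  have : lamCount q = Tcount q q := rfl
  rw [this, Tcount_eq]
  simp [resCount_self]

/-- complete exponential sum -/
noncomputable def expS (q : ℕ) [NeZero q] (a b : ZMod q) : ℂ :=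
  ∑ z ∈ circA q, ZMod.stdAddChar (a * z.1 + b * z.2)

/-- incomplete linear sum -/
noncomputable def expF (q : ℕ) [NeZero q] (H : ℕ) (a : ZMod q) : ℂ :=
  ∑ m ∈ Finset.Icc 1 H, ZMod.stdAddChar (-(a * (m : ZMod q)))

lemma expF_inv (q : ℕ) [NeZero q] (H : ℕ) (x : ZMod q) :
    ∑ a : ZMod q, (ZMod.stdAddChar (a * x) : ℂ) * expF q H a = q * resCount q H x := by
  simp only [expF, Finset.mul_sum]
  rw [Finset.sum_comm]
  have : ∀ m ∈ Finset.Icc 1 H, ∑ a : ZMod q, (ZMod.stdAddChar (a * x) : ℂ) *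
      ZMod.stdAddChar (-(a * (m : ZMod q))) = if (m : ZMod q) = x then (q:ℂ) else 0 := by
    intro m _
    have h := AddChar.sum_mulShift (x - (m : ZMod q)) (ZMod.isPrimitive_stdAddChar q)
    have h2 : ∀ a : ZMod q, (ZMod.stdAddChar (a * x) : ℂ) * ZMod.stdAddChar (-(a * (m : ZMod q)))
        = ZMod.stdAddChar (a * (x - (m : ZMod q))) := by
      intro a; rw [← AddChar.map_add_eq_mul]; congr 1; ring
    simp only [h2, h, sub_eq_zero, ZMod.card, eq_comm (a := x)]
    split_ifs <;> simp
  rw [Finset.sum_congr rfl this, ← Finset.sum_filter, Finset.sum_const, resCount, nsmul_eq_mul,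
    mul_comm]

lemma T_fourier (q : ℕ) [NeZero q] (H : ℕ) :
    (q:ℂ)^2 * (Tcount H q : ℂ) = ∑ a : ZMod q, ∑ b : ZMod q, expF q H a * expF q H b * expS q a b := by
  have h1 : ∀ z : ZMod q × ZMod q, ((q:ℂ) * resCount q H z.1) * (q * resCount q H z.2) =
      ∑ a : ZMod q, ∑ b : ZMod q, expF q H a * expF q H b * ZMod.stdAddChar (a * z.1 + b * z.2) := by
    intro z
    rw [← expF_inv, ← expF_inv, Finset.sum_mul_sum]
    refine Finset.sum_congr rfl fun a _ => Finset.sum_congr rfl fun b _ => ?_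
    rw [AddChar.map_add_eq_mul]; ring
  rw [Tcount_eq]
  push_cast
  rw [Finset.mul_sum]
  have h2 : ∀ z ∈ circA q, (q:ℂ)^2 * ((resCount q H z.1 : ℂ) * resCount q H z.2) =
      ∑ a : ZMod q, ∑ b : ZMod q, expF q H a * expF q H b * ZMod.stdAddChar (a * z.1 + b * z.2) := by
    intro z _; rw [← h1]; ring
  rw [Finset.sum_congr rfl h2, Finset.sum_comm]
  refine Finset.sum_congr rfl fun a _ => ?_
  rw [Finset.sum_comm]
  refine Finset.sum_congr rfl fun b _ => ?_
  rw [expS, Finset.mul_sum]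

lemma expS_zero (q : ℕ) [NeZero q] : expS q 0 0 = lamCount q := by
  simp [expS, lamCount_eq]

lemma expF_zero (q : ℕ) [NeZero q] (H : ℕ) : expF q H 0 = H := by
  simp [expF]

lemma expS_shift (d : ℕ) [NeZero d] (a b t : ZMod (d^2)) :
    expS (d^2) a b = ∑ z ∈ circA (d^2), ZMod.stdAddChar (a * z.1 + b * z.2) *
      ZMod.stdAddChar (t * ((d : ZMod (d^2)) * (a * z.2 - b * z.1))) := by
  have hd : (d : ZMod (d^2))^2 = 0 := by
    have := ZMod.natCast_self (d^2)
    push_cast at this; exact this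
  have hA : ∀ (s : ZMod (d^2)) (z : ZMod (d^2) × ZMod (d^2)), z ∈ circA (d^2) →
      (z.1 + (d : ZMod (d^2)) * s * z.2, z.2 - (d : ZMod (d^2)) * s * z.1) ∈ circA (d^2) := by
    intro s z hz
    simp only [circA, Finset.mem_filter, Finset.mem_univ, true_and] at hz ⊢
    linear_combination hz + s^2 * (z.1^2 + z.2^2) * hd
  rw [expS]
  symm
  apply Finset.sum_bij' (fun z _ => (z.1 + (d : ZMod (d^2)) * t * z.2, z.2 - (d : ZMod (d^2)) * t * z.1))
    (fun z _ => (z.1 + (d : ZMod (d^2)) * (-t) * z.2, z.2 - (d : ZMod (d^2)) * (-t) * z.1))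
  · intro z hz; exact hA t z hz
  · intro z hz; exact hA (-t) z hz
  · intro z hz
    ext
    · dsimp only; linear_combination t^2 * z.1 * hd
    · dsimp only; linear_combination t^2 * z.2 * hd
  · intro z hz
    ext
    · dsimp only; linear_combination t^2 * z.1 * hd
    · dsimp only; linear_combination t^2 * z.2 * hd
  · intro z hz
    rw [← AddChar.map_add_eq_mul]; congr 1; ring

lemma norm_expS_le (d : ℕ) [NeZero d] (a b : ZMod (d^2)) :
    ‖expS (d^2) a b‖ ≤ ((circSet a.val b.val d).card : ℝ) := by
  have hd0 : (d:ℤ) ≠ 0 := by exact_mod_cast NeZero.ne d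
  have h1 : ((d^2 : ℕ) : ℂ) * expS (d^2) a b = ((d^2 : ℕ) : ℂ) *
      ∑ z ∈ (circA (d^2)).filter (fun z => (d : ZMod (d^2)) * (a * z.2 - b * z.1) = 0),
        (ZMod.stdAddChar (a * z.1 + b * z.2) : ℂ) := by
    have : ((d^2 : ℕ) : ℂ) * expS (d^2) a b = ∑ t : ZMod (d^2), expS (d^2) a b := by
      simp [ZMod.card]
    rw [this, Finset.sum_congr rfl (fun t _ => expS_shift d a b t), Finset.sum_comm,
      Finset.mul_sum, Finset.sum_filter]
    refine Finset.sum_congr rfl fun z _ => ?_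
    rw [← Finset.mul_sum, AddChar.sum_mulShift _ (ZMod.isPrimitive_stdAddChar (d^2)), ZMod.card]
    split_ifs
    · ring
    · simp
  have h2 := mul_left_cancel₀ (by exact_mod_cast NeZero.ne (d^2)) h1
  rw [h2]
  refine (norm_sum_le _ _).trans ?_
  simp only [AddChar.norm_apply, Finset.sum_const, nsmul_eq_mul, mul_one]
  norm_cast
  apply Finset.card_le_card_of_injOn (fun z => (z.1.val, z.2.val))
  · intro z hz
    simp only [Finset.coe_filter, Set.mem_ofPred_eq, circA, Finset.mem_filter, Finset.mem_univ,
      true_and] at hz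
    have : (z.1.val, z.2.val) ∈ circSet a.val b.val d := by
      rw [mem_circSet]
      refine ⟨⟨ZMod.val_lt _, ZMod.val_lt _⟩, ?_, ?_⟩
      · have : ((d^2 : ℕ) : ℤ) ∣ ((z.1.val : ℤ)^2 + (z.2.val : ℤ)^2 + 1) := by
          rw [← ZMod.intCast_zmod_eq_zero_iff_dvd]
          push_cast
          simpa using hz.1
        exact_mod_cast this
      · have : ((d^2 : ℕ) : ℤ) ∣ d * ((a.val : ℤ) * z.2.val - b.val * z.1.val) := by
          rw [← ZMod.intCast_zmod_eq_zero_iff_dvd]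
          push_cast
          simpa using hz.2
        push_cast at this
        rw [sq] at this
        exact (mul_dvd_mul_iff_left hd0).1 this
    exact this
  · intro z _ z' _ h
    simp only [Prod.mk.injEq] at h
    exact Prod.ext (ZMod.val_injective _ h.1) (ZMod.val_injective _ h.2)

lemma norm_expF_le (q : ℕ) [NeZero q] (H : ℕ) (a : ZMod q) (ha : a ≠ 0) :
    ‖expF q H a‖ ≤ q * (1 / (a.val : ℝ) + 1 / ((q - a.val : ℕ) : ℝ)) := by
  have hq : 0 < q := Nat.pos_of_neZero q
  have hv0 : 0 < a.val := Nat.pos_of_ne_zero ((ZMod.val_ne_zero a).2 ha)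
  have hv := ZMod.val_lt a
  have hqr : (0:ℝ) < q := by exact_mod_cast hq
  have hvr : (0:ℝ) < a.val := by exact_mod_cast hv0
  have hvq : (a.val:ℝ) < q := by exact_mod_cast hv
  have hsub : ((q - a.val : ℕ) : ℝ) = q - a.val := by push_cast [hv.le]; rfl
  rw [hsub]
  set w : ℂ := ZMod.stdAddChar (-a) with hw
  have hwn : ‖w‖ = 1 := AddChar.norm_apply _ _
  have hF : expF q H a = w * ∑ m ∈ Finset.range H, w^m := by
    rw [expF, Finset.mul_sum, Finset.range_eq_Ico, Finset.sum_Ico_eq_sum_range]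
    rw [show Finset.Icc 1 H = Finset.Ico 1 (H+1) from rfl, Finset.sum_Ico_eq_sum_range]
    simp only [Nat.add_sub_cancel, Nat.sub_zero]
    refine Finset.sum_congr rfl fun m _ => ?_
    rw [← pow_succ', hw, ← AddChar.map_nsmul_eq_pow]
    congr 1
    simp only [nsmul_eq_mul]; push_cast; ring
  have hgeo : ‖expF q H a‖ * ‖w - 1‖ ≤ 2 := by
    rw [hF, ← norm_mul, mul_assoc, geom_sum_mul, norm_mul, hwn, one_mul]
    refine (norm_sub_le _ _).trans ?_
    rw [norm_pow, hwn]; norm_num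
  have hw1 : ‖w - 1‖ = 2 * |Real.sin (Real.pi * a.val / q)| := by
    have : -a = ((-(a.val:ℤ) : ℤ) : ZMod q) := by simp
    rw [hw, this, ZMod.stdAddChar_coe]
    have e : (2 * (Real.pi:ℂ) * Complex.I * ((-(a.val:ℤ) : ℤ) : ℂ) / q) =
        Complex.I * ((-(2 * Real.pi * a.val / q) : ℝ) : ℂ) := by
      push_cast; ring
    rw [e, Complex.norm_exp_I_mul_ofReal_sub_one, Real.norm_eq_abs, abs_mul]
    have e2 : -(2 * Real.pi * a.val / q) / 2 = -(Real.pi * a.val / q) := by ring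
    rw [e2, Real.sin_neg, abs_neg]; norm_num
  have hpi := Real.pi_pos
  have key : ∃ u : ℝ, 0 < u ∧ 1/u ≤ 1 / (a.val : ℝ) + 1 / (q - a.val : ℝ) ∧
      2 * u / q ≤ |Real.sin (Real.pi * a.val / q)| := by
    have i1 : 0 < 1 / (a.val : ℝ) := by positivity
    have i2 : 0 < 1 / (q - a.val : ℝ) := by
      have : (0:ℝ) < q - a.val := by linarith
      positivity
    rcases le_total (2 * (a.val:ℝ)) q with h | h
    · refine ⟨a.val, hvr, by linarith, ?_⟩
      have hb : |Real.pi * a.val / q| ≤ Real.pi / 2 := by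
        rw [abs_of_pos (by positivity), div_le_div_iff₀ hqr two_pos]
        nlinarith
      have := Real.mul_abs_le_abs_sin hb
      rw [abs_of_pos (by positivity)] at this
      refine le_trans (le_of_eq ?_) this
      field_simp
    · refine ⟨q - a.val, by linarith, by linarith, ?_⟩
      have hs : Real.sin (Real.pi * a.val / q) = Real.sin (Real.pi * (q - a.val) / q) := by
        rw [← Real.sin_pi_sub]; congr 1; field_simp
      have hp : 0 < Real.pi * (q - a.val) / q := by
        have : (0:ℝ) < q - a.val := by linarith
        positivity
      have hb : |Real.pi * (q - a.val) / q| ≤ Real.pi / 2 := by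
        rw [abs_of_pos hp, div_le_div_iff₀ hqr two_pos]
        nlinarith
      have := Real.mul_abs_le_abs_sin hb
      rw [hs]
      rw [abs_of_pos hp] at this
      refine le_trans (le_of_eq ?_) this
      field_simp
  obtain ⟨u, hu, hu1, hu2⟩ := key
  have h3 : ‖expF q H a‖ * (4 * u / q) ≤ 2 := by
    refine le_trans (mul_le_mul_of_nonneg_left ?_ (norm_nonneg _)) hgeo
    rw [hw1]
    calc 4 * u / q = 2 * (2 * u / q) := by ring
      _ ≤ _ := by linarith
  calc ‖expF q H a‖ = ‖expF q H a‖ * (4 * u / q) * (q / (4 * u)) := by field_simp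
    _ ≤ 2 * (q / (4*u)) := by gcongr
    _ = q * (1/u) / 2 := by field_simp; norm_num
    _ ≤ q * (1/u) := by
      have : 0 < q * (1/u) := by positivity
      linarith
    _ ≤ _ := by gcongr
lemma sum_gcd_div (d q : ℕ) (hd : 0 < d) :
    ∑ v ∈ Finset.Ico 1 q, (1 / (v:ℝ)) * (Nat.gcd v d : ℝ) ≤ d.divisors.card * (1 + Real.log q) := by
  have h1 : ∀ v ∈ Finset.Ico 1 q, (1 / (v:ℝ)) * (Nat.gcd v d : ℝ) ≤
      ∑ g ∈ d.divisors, if g ∣ v then (g:ℝ) / v else 0 := by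
    intro v hv
    have := Finset.single_le_sum (f := fun g : ℕ => if g ∣ v then (g:ℝ) / v else 0)
      (s := d.divisors) (fun g _ => by split_ifs <;> positivity) (a := Nat.gcd v d)
      (Nat.mem_divisors.2 ⟨Nat.gcd_dvd_right _ _, hd.ne'⟩)
    refine le_trans (le_of_eq ?_) this
    simp only [if_pos (Nat.gcd_dvd_left v d)]
    ring
  refine (Finset.sum_le_sum h1).trans ?_
  rw [Finset.sum_comm]
  have h2 : ∀ g ∈ d.divisors, ∑ v ∈ Finset.Ico 1 q, (if g ∣ v then (g:ℝ) / v else 0) ≤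
      1 + Real.log q := by
    intro g hg
    have hg0 : 0 < g := Nat.pos_of_mem_divisors hg
    refine le_trans ?_ (harmonic_le_one_add_log q)
    rw [harmonic_eq_sum_Icc]
    push_cast
    rw [← Finset.sum_filter]
    have inj : Set.InjOn (fun v : ℕ => v / g)
        ((Finset.Ico 1 q).filter (fun v => g ∣ v) : Finset ℕ) := by
      intro v hv v' hv' h
      simp only [Finset.coe_filter, Set.mem_ofPred_eq] at hv hv'
      exact Nat.div_left_inj hv.2 hv'.2 |>.1 h
    calc _ = ∑ v ∈ (Finset.Ico 1 q).filter (fun v => g ∣ v), (((v / g : ℕ) : ℝ))⁻¹ := by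
          refine Finset.sum_congr rfl fun v hv => ?_
          simp only [Finset.mem_filter] at hv
          rw [Nat.cast_div hv.2 (by exact_mod_cast hg0.ne'), inv_div]
      _ = ∑ k ∈ ((Finset.Ico 1 q).filter (fun v => g ∣ v)).image (fun v => v / g), ((k:ℝ))⁻¹ := by
          rw [Finset.sum_image inj]
      _ ≤ _ := by
          apply Finset.sum_le_sum_of_subset_of_nonneg
          · intro k hk
            simp only [Finset.mem_image, Finset.mem_filter, Finset.mem_Ico] at hk
            obtain ⟨v, ⟨⟨hv1, hv2⟩, hv3⟩, rfl⟩ := hk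
            rw [Finset.mem_Icc]
            exact ⟨Nat.div_pos (Nat.le_of_dvd hv1 hv3) hg0, (Nat.div_le_self _ _).trans hv2.le⟩
          · intros; positivity
  refine (Finset.sum_le_sum h2).trans ?_
  rw [Finset.sum_const, nsmul_eq_mul]

lemma sum_R (d q : ℕ) [NeZero q] (hd : 0 < d) (hdq : d ∣ q) :
    ∑ a ∈ (Finset.univ : Finset (ZMod q)).erase 0,
      (1 / (a.val : ℝ) + 1 / ((q - a.val : ℕ) : ℝ)) * (Nat.gcd a.val d : ℝ) ≤
      2 * d.divisors.card * (1 + Real.log q) := by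
  have h1 : ∑ a ∈ (Finset.univ : Finset (ZMod q)).erase 0,
      (1 / (a.val : ℝ) + 1 / ((q - a.val : ℕ) : ℝ)) * (Nat.gcd a.val d : ℝ) =
      ∑ v ∈ Finset.Ico 1 q, (1 / (v : ℝ) + 1 / ((q - v : ℕ) : ℝ)) * (Nat.gcd v d : ℝ) := by
    refine Finset.sum_nbij' (fun a => a.val) (fun v => (v : ZMod q)) ?_ ?_ ?_ ?_ ?_
    · intro a ha
      have := (ZMod.val_ne_zero a).2 (Finset.ne_of_mem_erase ha)
      have := ZMod.val_lt a
      rw [Finset.mem_Ico]; omega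
    · intro v hv
      rw [Finset.mem_Ico] at hv
      rw [Finset.mem_erase]
      refine ⟨?_, Finset.mem_univ _⟩
      rw [Ne, ZMod.natCast_eq_zero_iff]
      intro h
      have := Nat.le_of_dvd (by omega) h
      omega
    · intro a _; simp
    · intro v hv
      rw [Finset.mem_Ico] at hv
      exact ZMod.val_cast_of_lt hv.2
    · intro a _; rfl
  have h2 : ∑ v ∈ Finset.Ico 1 q, (1 / ((q - v : ℕ) : ℝ)) * (Nat.gcd v d : ℝ) =
      ∑ v ∈ Finset.Ico 1 q, (1 / (v:ℝ)) * (Nat.gcd v d : ℝ) := by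
    refine Finset.sum_nbij' (fun v => q - v) (fun v => q - v) ?_ ?_ ?_ ?_ ?_
    · intro v hv; rw [Finset.mem_Ico] at hv ⊢; omega
    · intro v hv; rw [Finset.mem_Ico] at hv ⊢; omega
    · intro v hv; rw [Finset.mem_Ico] at hv; omega
    · intro v hv; rw [Finset.mem_Ico] at hv; omega
    · intro v hv
      rw [Finset.mem_Ico] at hv
      have : Nat.gcd (q - v) d = Nat.gcd v d := by
        apply Nat.dvd_antisymm
        · refine Nat.dvd_gcd ?_ (Nat.gcd_dvd_right _ _)
          have k1 : Nat.gcd (q - v) d ∣ q := (Nat.gcd_dvd_right _ _).trans hdq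
          have k2 := Nat.gcd_dvd_left (q - v) d
          have := Nat.dvd_sub k1 k2
          rwa [Nat.sub_sub_self hv.2.le] at this
        · exact Nat.dvd_gcd (Nat.dvd_sub ((Nat.gcd_dvd_right _ _).trans hdq)
            (Nat.gcd_dvd_left _ _)) (Nat.gcd_dvd_right _ _)
      rw [this]
  rw [h1]
  simp only [add_mul]
  rw [Finset.sum_add_distrib, h2]
  have := sum_gcd_div d q hd
  linarith

lemma main_bound (H d : ℕ) (hd : Squarefree d) :
    |(Tcount H (d^2) : ℝ) - (H : ℝ)^2 * lamCount (d^2) / ((d : ℝ)^2)^2| ≤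
      2 * H * ((d.divisors.card:ℝ)^2 / d) * (2 * d.divisors.card * (1 + Real.log ((d^2 : ℕ):ℝ))) +
      (d.divisors.card:ℝ)^2 * d * (2 * d.divisors.card * (1 + Real.log ((d^2 : ℕ):ℝ)))^2 := by
  have hd0 : d ≠ 0 := hd.ne_zero
  have : NeZero d := ⟨hd0⟩
  have hdr : (0:ℝ) < d := by exact_mod_cast Nat.pos_of_ne_zero hd0
  set q := d^2 with hq
  set R : ℝ := 2 * d.divisors.card * (1 + Real.log (q:ℝ)) with hR
  set K : ℝ := (d.divisors.card:ℝ)^2 * d with hK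
  have hK0 : 0 ≤ K := by positivity
  set r : ZMod q → ℝ := fun a => 1 / (a.val : ℝ) + 1 / ((q - a.val : ℕ) : ℝ) with hr
  have hr0 : ∀ a, 0 ≤ r a := fun a => by simp only [hr]; positivity
  set g : ZMod q → ℝ := fun a => (Nat.gcd a.val d : ℝ) with hg
  have hg0 : ∀ a, 0 ≤ g a := fun a => by simp only [hg]; positivity
  set E := (Finset.univ : Finset (ZMod q)).erase 0 with hE
  have hsum : ∑ a ∈ E, r a * g a ≤ R :=
    sum_R d q (Nat.pos_of_ne_zero hd0) (dvd_pow_self _ two_ne_zero)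
  have hsum0 : 0 ≤ ∑ a ∈ E, r a * g a :=
    Finset.sum_nonneg fun a _ => mul_nonneg (hr0 a) (hg0 a)
  have hS : ∀ a b : ZMod q, ‖expS q a b‖ ≤ K * (Nat.gcd (Nat.gcd a.val b.val) d : ℝ) := by
    intro a b
    refine (norm_expS_le d a b).trans ?_
    have := card_circSet a.val b.val d hd
    rw [hK]
    exact_mod_cast this
  have hF : ∀ a ∈ E, ‖expF q H a‖ ≤ q * r a := fun a ha =>
    norm_expF_le q H a (Finset.ne_of_mem_erase ha)
  set G : ZMod q → ZMod q → ℂ := fun a b => expF q H a * expF q H b * expS q a b with hG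
  have hqr : (q:ℝ) = (d:ℝ)^2 := by rw [hq]; push_cast; rfl
  have hq0 : (0:ℝ) < q := by rw [hqr]; positivity
  have hGa : ∀ a ∈ E, ‖G a 0‖ ≤ H * q * K * (r a * g a) := by
    intro a ha
    simp only [hG, norm_mul, expF_zero, Complex.norm_natCast]
    have h1 := hS a 0
    simp only [ZMod.val_zero, Nat.gcd_zero_right] at h1
    calc _ ≤ (q * r a) * H * (K * g a) := by
          have := hr0 a
          gcongr
          exact hF a ha
      _ = _ := by ring
  have hGb : ∀ a ∈ E, ‖G 0 a‖ ≤ H * q * K * (r a * g a) := by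
    intro a ha
    simp only [hG, norm_mul, expF_zero, Complex.norm_natCast]
    have h1 := hS 0 a
    simp only [ZMod.val_zero, Nat.gcd_zero_left] at h1
    calc _ ≤ H * (q * r a) * (K * g a) := by
          have := hr0 a
          gcongr
          exact hF a ha
      _ = _ := by ring
  have hGab : ∀ a ∈ E, ∀ b ∈ E, ‖G a b‖ ≤ q^2 * K * ((r a * g a) * (r b * g b)) := by
    intro a ha b hb
    simp only [hG, norm_mul]
    have h1 : ‖expS q a b‖ ≤ K * (g a * g b) := by
      refine (hS a b).trans ?_
      gcongr
      simp only [hg]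
      have hpos : 0 < d := Nat.pos_of_ne_zero hd0
      have k1 : Nat.gcd (Nat.gcd a.val b.val) d ≤ Nat.gcd a.val d :=
        Nat.le_of_dvd (Nat.gcd_pos_of_pos_right _ hpos)
          (Nat.gcd_dvd_gcd_of_dvd_left _ (Nat.gcd_dvd_left _ _))
      have k2 : 1 ≤ Nat.gcd b.val d := Nat.gcd_pos_of_pos_right _ hpos
      have : Nat.gcd (Nat.gcd a.val b.val) d ≤ Nat.gcd a.val d * Nat.gcd b.val d := by nlinarith
      exact_mod_cast this
    calc _ ≤ (q * r a) * (q * r b) * (K * (g a * g b)) := by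
          have := hr0 a
          have := hr0 b
          gcongr
          · exact hF a ha
          · exact hF b hb
      _ = _ := by ring
  have hsplit : ∑ a : ZMod q, ∑ b : ZMod q, G a b = G 0 0 + ∑ b ∈ E, G 0 b +
      (∑ a ∈ E, G a 0 + ∑ a ∈ E, ∑ b ∈ E, G a b) := by
    rw [← Finset.add_sum_erase _ _ (Finset.mem_univ (0 : ZMod q)), ← Finset.sum_add_distrib,
      ← Finset.add_sum_erase _ _ (Finset.mem_univ (0 : ZMod q))]
    congr 1
    refine Finset.sum_congr rfl fun a _ => ?_
    rw [← Finset.add_sum_erase _ _ (Finset.mem_univ (0 : ZMod q))]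
  have hG00 : G 0 0 = (H:ℂ)^2 * lamCount q := by
    simp only [hG, expF_zero, expS_zero]; ring
  have hT := T_fourier q H
  have hdiff : (q:ℂ)^2 * (Tcount H q : ℂ) - (H:ℂ)^2 * lamCount q =
      ∑ b ∈ E, G 0 b + (∑ a ∈ E, G a 0 + ∑ a ∈ E, ∑ b ∈ E, G a b) := by
    rw [hT, ← hG00]
    change ∑ a : ZMod q, ∑ b : ZMod q, G a b - _ = _
    rw [hsplit]; ring
  have hn : ‖(q:ℂ)^2 * (Tcount H q : ℂ) - (H:ℂ)^2 * lamCount q‖ ≤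
      2 * (H * q * K * R) + q^2 * K * R^2 := by
    rw [hdiff]
    have b1 : ‖∑ b ∈ E, G 0 b‖ ≤ H * q * K * R := by
      refine (norm_sum_le_of_le _ hGb).trans ?_
      rw [← Finset.mul_sum]; gcongr
    have b2 : ‖∑ a ∈ E, G a 0‖ ≤ H * q * K * R := by
      refine (norm_sum_le_of_le _ hGa).trans ?_
      rw [← Finset.mul_sum]; gcongr
    have b3 : ‖∑ a ∈ E, ∑ b ∈ E, G a b‖ ≤ q^2 * K * R^2 := by
      refine (norm_sum_le_of_le _ (fun a ha => norm_sum_le_of_le _ (hGab a ha))).trans ?_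
      simp only [← Finset.mul_sum]
      rw [← Finset.sum_mul, ← sq]; gcongr
    have := norm_add_le (∑ b ∈ E, G 0 b) (∑ a ∈ E, G a 0 + ∑ a ∈ E, ∑ b ∈ E, G a b)
    have := norm_add_le (∑ a ∈ E, G a 0) (∑ a ∈ E, ∑ b ∈ E, G a b)
    linarith
  have hcast : (q:ℂ)^2 * (Tcount H q : ℂ) - (H:ℂ)^2 * lamCount q =
      (((q:ℝ)^2 * (Tcount H q : ℝ) - (H:ℝ)^2 * lamCount q : ℝ) : ℂ) := by push_cast; rfl
  rw [hcast, Complex.norm_real, Real.norm_eq_abs] at hn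
  rw [← hqr]
  have e : (Tcount H q : ℝ) - (H : ℝ)^2 * lamCount q / (q:ℝ)^2 =
      ((q:ℝ)^2 * (Tcount H q : ℝ) - (H:ℝ)^2 * lamCount q) / (q:ℝ)^2 := by
    field_simp
  rw [e, abs_div, abs_of_pos (by positivity : (0:ℝ) < (q:ℝ)^2), div_le_iff₀ (by positivity)]
  refine hn.trans (le_of_eq ?_)
  rw [hK, hqr]
  field_simp

lemma divisor_bound (η : ℝ) (hη : 0 < η) : ∃ C : ℝ, 1 ≤ C ∧ ∀ d : ℕ, Squarefree d →
    (d.divisors.card : ℝ) ≤ C * (d:ℝ)^η := by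
  obtain ⟨M, hM⟩ := exists_nat_ge ((2:ℝ)^(1/η))
  refine ⟨2^M, one_le_pow₀ (by norm_num), ?_⟩
  intro d hd
  have h1 : (d.divisors.card : ℝ) = ∏ p ∈ d.primeFactors, (2:ℝ) := by
    rw [Nat.card_divisors hd.ne_zero]
    push_cast
    refine Finset.prod_congr rfl fun p hp => ?_
    rw [Nat.factorization_eq_one_of_squarefree hd (Nat.prime_of_mem_primeFactors hp) (Nat.dvd_of_mem_primeFactors hp)]
    norm_num
  have h2 : (d:ℝ)^η = ∏ p ∈ d.primeFactors, (p:ℝ)^η := by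
    conv_lhs => rw [← Nat.prod_primeFactors_of_squarefree hd]
    push_cast
    rw [Real.finsetProd_rpow]
    intros; positivity
  have h3 : ∀ p ∈ d.primeFactors, (2:ℝ) ≤ (if p < M then 2 else 1) * (p:ℝ)^η := by
    intro p hp
    have hp1 : (1:ℝ) ≤ p := by exact_mod_cast (Nat.prime_of_mem_primeFactors hp).one_lt.le
    split_ifs with h
    · have := Real.one_le_rpow hp1 hη.le
      linarith
    · have hMp : (M:ℝ) ≤ p := by exact_mod_cast not_lt.1 h
      have := Real.rpow_le_rpow (by positivity) (hM.trans hMp) hη.le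
      rw [← Real.rpow_mul (by norm_num), one_div, inv_mul_cancel₀ hη.ne', Real.rpow_one] at this
      linarith
  rw [h1, h2]
  refine (Finset.prod_le_prod (fun _ _ => by norm_num) h3).trans ?_
  rw [Finset.prod_mul_distrib]
  refine mul_le_mul_of_nonneg_right ?_ (Finset.prod_nonneg fun _ _ => by positivity)
  rw [Finset.prod_ite]
  simp only [Finset.prod_const, mul_one, one_pow]
  refine pow_le_pow_right₀ (by norm_num) ?_
  calc _ ≤ (Finset.range M).card := Finset.card_le_card (by
        intro p hp; simp only [Finset.mem_filter] at hp; simpa using hp.2)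
    _ = M := by simp

theorem stmt_16 : ∀ ε : ℝ, 0 < ε → ∃ C : ℝ, 0 < C ∧
    ∀ (H d : ℕ), 0 < H → Squarefree d →
      |(Tcount H (d^2) : ℝ) - (H : ℝ)^2 * lamCount (d^2) / ((d : ℝ)^2)^2| ≤
        C * (H : ℝ) ^ (ε : ℝ) *
          ((H : ℝ) / Real.sqrt ((d : ℝ)^2) + Real.sqrt ((d : ℝ)^2) +
            ((d : ℝ)^2) / H) := by
  intro ε hε
  set δ : ℝ := min (ε/2) (1/2) with hδ
  have hδ0 : 0 < δ := by rw [hδ]; positivity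
  have hδ1 : δ ≤ ε/2 := min_le_left _ _
  have hδ2 : δ ≤ 1/2 := min_le_right _ _
  set η : ℝ := δ/6 with hη
  have hη0 : 0 < η := by positivity
  obtain ⟨C₁, hC₁, hdiv⟩ := divisor_bound η hη0
  set C₂ : ℝ := 1 + 2/η with hC₂
  have hC₂0 : 0 < C₂ := by positivity
  set C : ℝ := 4 * C₁^3 * C₂ + 4 * C₁^4 * C₂^2 with hC
  have hC0 : 0 < C := by positivity
  refine ⟨2 * C, by positivity, ?_⟩
  intro H d hH hd
  have hH1 : (1:ℝ) ≤ H := by exact_mod_cast hH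
  have hd1 : (1:ℝ) ≤ d := by exact_mod_cast Nat.pos_of_ne_zero hd.ne_zero
  have hd0 : (0:ℝ) < d := by linarith
  rw [Real.sqrt_sq hd0.le]
  set D : ℝ := (d:ℝ)^η with hD
  have hD1 : 1 ≤ D := Real.one_le_rpow hd1 hη0.le
  have hD6 : D^6 = (d:ℝ)^δ := by
    rw [hD, ← Real.rpow_natCast, ← Real.rpow_mul hd0.le, hη]; congr 1; push_cast; ring
  have ht := hdiv d hd
  set t : ℝ := (d.divisors.card : ℝ) with htt
  have ht0 : 0 ≤ t := by positivity
  have hlog : 1 + Real.log ((d^2 : ℕ):ℝ) ≤ C₂ * D := by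
    have := Real.log_le_rpow_div hd0.le hη0
    push_cast
    rw [Real.log_pow, hC₂]
    push_cast
    have e : (1 + 2/η) * D = D + 2 * (D / η) := by ring
    rw [e]; linarith
  have hlog0 : 0 ≤ 1 + Real.log ((d^2 : ℕ):ℝ) := by
    have : 0 ≤ Real.log ((d^2 : ℕ):ℝ) := Real.log_natCast_nonneg _
    linarith
  have hmain : |(Tcount H (d^2) : ℝ) - (H : ℝ)^2 * lamCount (d^2) / ((d : ℝ)^2)^2| ≤
      C * (d:ℝ)^δ * (H / d + d) := by
    refine (main_bound H d hd).trans ?_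
    rw [← hD6]
    set l := 1 + Real.log ((d^2 : ℕ):ℝ)
    calc _ ≤ 2 * H * ((C₁ * D)^2 / d) * (2 * (C₁ * D) * (C₂ * D)) +
          (C₁ * D)^2 * d * (2 * (C₁ * D) * (C₂ * D))^2 := by gcongr
      _ = 4 * C₁^3 * C₂ * D^4 * (H / d) + 4 * C₁^4 * C₂^2 * D^6 * d := by ring
      _ ≤ 4 * C₁^3 * C₂ * D^6 * (H / d) + 4 * C₁^4 * C₂^2 * D^6 * d := by
        gcongr
        norm_num
      _ ≤ _ := by
        rw [hC]
        have : 0 ≤ 4 * C₁^3 * C₂ * D^6 * d := by positivity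
        have : 0 ≤ 4 * C₁^4 * C₂^2 * D^6 * (H / d) := by positivity
        nlinarith
  refine hmain.trans ?_
  have hHε : 1 ≤ (H:ℝ)^ε := Real.one_le_rpow hH1 hε.le
  rcases le_total (d:ℝ) ((H:ℝ)^2) with h | h
  · have h1 : (d:ℝ)^δ ≤ (H:ℝ)^ε := by
      calc (d:ℝ)^δ ≤ (d:ℝ)^(ε/2) := Real.rpow_le_rpow_of_exponent_le hd1 hδ1
        _ ≤ ((H:ℝ)^2)^(ε/2) := Real.rpow_le_rpow hd0.le h (by positivity)
        _ = (H:ℝ)^ε := by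
          rw [← Real.rpow_natCast, ← Real.rpow_mul (by positivity)]; congr 1; push_cast; ring
    have h2 : 0 ≤ (d:ℝ)^2 / H := by positivity
    calc C * (d:ℝ)^δ * (H / d + d) ≤ C * (H:ℝ)^ε * (H / d + d + (d:ℝ)^2/H) := by
          refine mul_le_mul ?_ (by linarith) (by positivity) (by positivity)
          gcongr
      _ ≤ _ := by
          have : 0 ≤ C * (H:ℝ)^ε * (H / d + d + (d:ℝ)^2/H) := by positivity
          linarith
  · have h1 : (d:ℝ)^δ ≤ Real.sqrt d := by
      rw [Real.sqrt_eq_rpow]; exact Real.rpow_le_rpow_of_exponent_le hd1 hδ2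
    have h2 : (H:ℝ) ≤ Real.sqrt d := Real.le_sqrt_of_sq_le h
    have h3 : (d:ℝ)^δ * H ≤ d := by
      calc (d:ℝ)^δ * H ≤ Real.sqrt d * Real.sqrt d := by gcongr
        _ = d := Real.mul_self_sqrt hd0.le
    have h4 : (H:ℝ) / d ≤ d := by
      rw [div_le_iff₀ hd0]; nlinarith
    have h5 : (d:ℝ)^δ * d ≤ (d:ℝ)^2 / H := by
      rw [le_div_iff₀ (by linarith)]; nlinarith
    calc C * (d:ℝ)^δ * (H / d + d) ≤ C * (d:ℝ)^δ * (d + d) := by gcongr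
      _ = 2 * C * 1 * ((d:ℝ)^δ * d) := by ring
      _ ≤ 2 * C * (H:ℝ)^ε * ((d:ℝ)^2/H) := by gcongr
      _ ≤ _ := by
        gcongr
        have : 0 ≤ (H:ℝ) / d := by positivity
        linarith
end

section
/- For every ε > 0, the number S(H) of pairs of positive integers x, y ≤ H such that x² + y² + 1 is squarefree satisfies S(H) = c·H² + O_ε(H^{4/3+ε}), where c = Π_p (1 − λ(p²)/p⁴) and λ(q) counts pairs 1 ≤ x, y ≤ q with x² + y² + 1 ≡ 0 (mod q). -/
open Finset

/-- S(H) = number of pairs of positive integers x, y ≤ H with x² + y² + 1 squarefree. -/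
def Scount (H : ℕ) : ℕ :=
  ((Finset.Icc 1 H ×ˢ Finset.Icc 1 H).filter
    (fun p : ℕ × ℕ => Squarefree (p.1^2 + p.2^2 + 1))).card


lemma aux_pow_bound (ε : ℝ) (hε : 0 < ε) (p : ℕ) (hp : 2 ≤ p) (k : ℕ) :
    ((k : ℝ) + 1) ≤ (if (p : ℝ) ^ ε < 2 then max 1 (1 / (ε * Real.log 2)) else 1) * ((p : ℝ) ^ k) ^ ε := by
  have hp2 : (2 : ℝ) ≤ p := by exact_mod_cast hp
  have e1 : ((p : ℝ) ^ k) ^ ε = ((p : ℝ) ^ ε) ^ k := by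
    rw [← Real.rpow_natCast, ← Real.rpow_natCast, ← Real.rpow_mul (by positivity),
      ← Real.rpow_mul (by positivity), mul_comm]
  split_ifs with h
  · have hl : 0 < Real.log 2 := Real.log_pos (by norm_num)
    have h2 : (1 : ℝ) + k * (ε * Real.log 2) ≤ ((p : ℝ) ^ k) ^ ε := by
      calc (1 : ℝ) + k * (ε * Real.log 2) ≤ Real.exp (k * (ε * Real.log 2)) := by
            rw [add_comm]; exact Real.add_one_le_exp _
        _ = ((2 : ℝ) ^ k) ^ ε := by
            rw [← Real.rpow_natCast, ← Real.rpow_mul (by norm_num), Real.rpow_def_of_pos (by norm_num)]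
            ring_nf
        _ ≤ _ := by gcongr
    have hK1 : (1 : ℝ) ≤ max 1 (1 / (ε * Real.log 2)) := le_max_left _ _
    have hK2 : (1 : ℝ) ≤ max 1 (1 / (ε * Real.log 2)) * (ε * Real.log 2) := by
      have : (1 / (ε * Real.log 2)) * (ε * Real.log 2) = 1 := by field_simp
      calc (1 : ℝ) = (1 / (ε * Real.log 2)) * (ε * Real.log 2) := this.symm
        _ ≤ _ := mul_le_mul_of_nonneg_right (le_max_right _ _) (by positivity)
    set K := max 1 (1 / (ε * Real.log 2))
    calc (k : ℝ) + 1 ≤ k * (K * (ε * Real.log 2)) + K := by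
          have : (k : ℝ) * 1 ≤ k * (K * (ε * Real.log 2)) := by gcongr
          linarith
      _ = K * (1 + k * (ε * Real.log 2)) := by ring
      _ ≤ _ := by gcongr
  · rw [e1, one_mul]
    have := one_add_mul_le_pow (a := (1 : ℝ)) (by norm_num) k
    calc (k : ℝ) + 1 ≤ 2 ^ k := by norm_num at this; linarith
      _ ≤ _ := by
        push Not at h
        gcongr

/-- The classical divisor bound. -/
lemma divisor_bound_s18 (ε : ℝ) (hε : 0 < ε) :
    ∃ C : ℝ, 1 ≤ C ∧ ∀ n : ℕ, 0 < n → ((n.divisors.card : ℕ) : ℝ) ≤ C * (n : ℝ) ^ ε := by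
  set K := max 1 (1 / (ε * Real.log 2)) with hK
  have hK1 : (1 : ℝ) ≤ K := le_max_left _ _
  set P : ℕ := ⌈(2 : ℝ) ^ (1 / ε)⌉₊ with hP
  refine ⟨K ^ P, one_le_pow₀ hK1, fun n hn => ?_⟩
  rw [Nat.card_divisors hn.ne']
  push_cast
  have hnn : (n : ℝ) = ∏ p ∈ n.primeFactors, ((p : ℝ) ^ (n.factorization p)) := by
    conv_lhs => rw [← Nat.prod_factorization_pow_eq_self hn.ne']
    rw [Finsupp.prod]; push_cast; rfl
  calc ∏ p ∈ n.primeFactors, ((n.factorization p : ℝ) + 1)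
      ≤ ∏ p ∈ n.primeFactors, ((if (p : ℝ) ^ ε < 2 then K else 1) *
          ((p : ℝ) ^ (n.factorization p)) ^ ε) := by
        apply Finset.prod_le_prod
        · intros; positivity
        · intro p hp
          exact aux_pow_bound ε hε p (Nat.prime_of_mem_primeFactors hp).two_le _
    _ = (∏ p ∈ n.primeFactors, (if (p : ℝ) ^ ε < 2 then K else 1)) * (n : ℝ) ^ ε := by
        rw [Finset.prod_mul_distrib]
        congr 1
        rw [hnn, Real.finsetProd_rpow]
        intros; positivity
    _ ≤ _ := by
        gcongr
        rw [Finset.prod_ite, Finset.prod_const, Finset.prod_const, one_pow, mul_one]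
        apply pow_le_pow_right₀ hK1
        calc _ ≤ (Finset.range P).card := by
              apply Finset.card_le_card
              intro p hp
              rw [Finset.mem_filter] at hp
              rw [Finset.mem_range, hP, Nat.lt_ceil]
              have h1 := hp.2
              calc (p : ℝ) = ((p : ℝ) ^ ε) ^ (1 / ε) := by
                    rw [← Real.rpow_mul (by positivity)]
                    rw [mul_one_div_cancel hε.ne', Real.rpow_one]
                _ < 2 ^ (1 / ε) := by
                    apply Real.rpow_lt_rpow (by positivity) h1 (by positivity)
          _ = P := by simp


/-- number of solutions counted modulo q with the extra proportionality condition -/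
noncomputable def Bc (q d : ℕ) (m n : ℤ) : ℕ :=
  Nat.card {z : ZMod q × ZMod q // z.1 ^ 2 + z.2 ^ 2 + 1 = 0 ∧
    (d : ZMod q) * ((m : ZMod q) * z.2 - (n : ZMod q) * z.1) = 0}

lemma Bc_mul (a b : ℕ) (ha : 0 < a) (hb : 0 < b) (h : a.Coprime b) (m n : ℤ) :
    Bc ((a * b) ^ 2) (a * b) m n ≤ Bc (a ^ 2) a m n * Bc (b ^ 2) b m n := by
  have : NeZero (a ^ 2) := ⟨by positivity⟩
  have : NeZero (b ^ 2) := ⟨by positivity⟩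
  have hc : (a ^ 2).Coprime (b ^ 2) := Nat.Coprime.pow 2 2 h
  rw [mul_pow]
  unfold Bc
  rw [← Nat.card_prod]
  let e := ZMod.chineseRemainder hc
  let f := (RingHom.fst (ZMod (a ^ 2)) (ZMod (b ^ 2))).comp e.toRingHom
  let g := (RingHom.snd (ZMod (a ^ 2)) (ZMod (b ^ 2))).comp e.toRingHom
  have hfg : ∀ x y, f x = f y → g x = g y → x = y := by
    intro x y h1 h2
    apply e.injective
    exact Prod.ext h1 h2
  have ub : IsUnit ((b : ℕ) : ZMod (a ^ 2)) := by
    rw [ZMod.isUnit_iff_coprime]; exact Nat.Coprime.pow_right 2 h.symm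
  have ua : IsUnit ((a : ℕ) : ZMod (b ^ 2)) := by
    rw [ZMod.isUnit_iff_coprime]; exact Nat.Coprime.pow_right 2 h
  refine Nat.card_le_card_of_injective
    (fun z => (⟨(f z.1.1, f z.1.2), ?_, ?_⟩, ⟨(g z.1.1, g z.1.2), ?_, ?_⟩)) ?_
  · have := congrArg f z.2.1
    simpa using this
  · have := congrArg f z.2.2
    simp only [map_mul, map_sub, map_natCast, map_intCast, map_zero, Nat.cast_mul] at this
    rw [mul_comm (a : ZMod (a ^ 2)), mul_assoc] at this
    exact (ub.mul_right_eq_zero).1 this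
  · have := congrArg g z.2.1
    simpa using this
  · have := congrArg g z.2.2
    simp only [map_mul, map_sub, map_natCast, map_intCast, map_zero, Nat.cast_mul] at this
    rw [mul_assoc] at this
    exact (ua.mul_right_eq_zero).1 this
  · rintro ⟨⟨x, y⟩, hz⟩ ⟨⟨x', y'⟩, hz'⟩ hh
    simp only [Prod.mk.injEq, Subtype.mk.injEq] at hh ⊢
    exact ⟨hfg _ _ hh.1.1 hh.2.1, hfg _ _ hh.1.2 hh.2.2⟩

/-- number of roots of s² = -1 -/
noncomputable def rc (q : ℕ) : ℕ := Nat.card {s : ZMod q // s ^ 2 + 1 = 0}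

lemma rc_mul (a b : ℕ) (ha : 0 < a) (hb : 0 < b) (h : a.Coprime b) :
    rc (a * b) ≤ rc a * rc b := by
  have : NeZero a := ⟨by positivity⟩
  have : NeZero b := ⟨by positivity⟩
  unfold rc
  rw [← Nat.card_prod]
  let e := ZMod.chineseRemainder h
  let f := (RingHom.fst (ZMod a) (ZMod b)).comp e.toRingHom
  let g := (RingHom.snd (ZMod a) (ZMod b)).comp e.toRingHom
  have hfg : ∀ x y, f x = f y → g x = g y → x = y := by
    intro x y h1 h2
    apply e.injective
    exact Prod.ext h1 h2
  refine Nat.card_le_card_of_injective (fun z => (⟨f z.1, ?_⟩, ⟨g z.1, ?_⟩)) ?_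
  · have := congrArg f z.2
    simpa using this
  · have := congrArg g z.2
    simpa using this
  · rintro ⟨x, hz⟩ ⟨x', hz'⟩ hh
    simp only [Prod.mk.injEq, Subtype.mk.injEq] at hh ⊢
    exact hfg _ _ hh.1 hh.2

/-- λ as solutions in ZMod -/
noncomputable def lc (q : ℕ) : ℕ :=
  Nat.card {z : ZMod q × ZMod q // z.1 ^ 2 + z.2 ^ 2 + 1 = 0}

lemma lc_mul (a b : ℕ) (h : a.Coprime b) :
    lc (a * b) = lc a * lc b := by
  unfold lc
  rw [← Nat.card_prod]
  let e := ZMod.chineseRemainder h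
  apply Nat.card_congr
  refine ⟨fun z => (⟨((e z.1.1).1, (e z.1.2).1), ?_⟩, ⟨((e z.1.1).2, (e z.1.2).2), ?_⟩),
    fun w => ⟨(e.symm (w.1.1.1, w.2.1.1), e.symm (w.1.1.2, w.2.1.2)), ?_⟩, ?_, ?_⟩
  · have := congrArg (fun t => (e t).1) z.2
    simpa using this
  · have := congrArg (fun t => (e t).2) z.2
    simpa using this
  · apply e.injective
    have h1 := w.1.2
    have h2 := w.2.2
    simp only [map_add, map_pow, map_one, map_zero, RingEquiv.apply_symm_apply]
    exact Prod.ext (by simpa using h1) (by simpa using h2)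
  · rintro ⟨⟨x, y⟩, hz⟩
    simp
  · rintro ⟨⟨⟨x, y⟩, hz⟩, ⟨⟨x', y'⟩, hz'⟩⟩
    simp

lemma lc_eq_lamCount (q : ℕ) (hq : 0 < q) : lamCount q = lc q := by
  have : NeZero q := ⟨by positivity⟩
  unfold lc lamCount
  rw [← Nat.card_eq_finsetCard]
  apply Nat.card_congr
  refine Equiv.ofBijective (fun z => ⟨((z.1.1 : ZMod q), (z.1.2 : ZMod q)), ?_⟩) ⟨?_, ?_⟩
  · have := (Finset.mem_filter.1 z.2).2
    rw [← ZMod.intCast_zmod_eq_zero_iff_dvd] at this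
    simpa using this
  · rintro ⟨⟨x, y⟩, hz⟩ ⟨⟨x', y'⟩, hz'⟩ hh
    simp only [Subtype.mk.injEq, Prod.mk.injEq, Finset.mem_filter, Finset.mem_product, Finset.mem_Icc] at hh hz hz' ⊢
    have key : ∀ u v : ℕ, 1 ≤ u → u ≤ q → 1 ≤ v → v ≤ q → (u : ZMod q) = v → u = v := by
      intro u v h1 h2 h3 h4 h5
      rw [ZMod.natCast_eq_natCast_iff] at h5
      have h6 : (u : ℤ) ≡ v [ZMOD q] := (Int.natCast_modEq_iff).2 h5
      have h7 := h6.dvd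
      have h8 := Int.eq_zero_of_abs_lt_dvd h7 (by rw [abs_lt]; omega)
      omega
    exact ⟨key _ _ hz.1.1.1 hz.1.1.2 hz'.1.1.1 hz'.1.1.2 hh.1,
      key _ _ hz.1.2.1 hz.1.2.2 hz'.1.2.1 hz'.1.2.2 hh.2⟩
  · have key : ∀ u : ZMod q, ∃ v : ℕ, 1 ≤ v ∧ v ≤ q ∧ (v : ZMod q) = u := by
      intro u
      by_cases h : u.val = 0
      · refine ⟨q, hq, le_rfl, ?_⟩
        rw [ZMod.natCast_self]; exact ((ZMod.val_eq_zero u).1 h).symm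
      · exact ⟨u.val, by omega, (ZMod.val_lt u).le, ZMod.natCast_zmod_val u⟩
    rintro ⟨⟨x, y⟩, hz⟩
    obtain ⟨u, hu1, hu2, hu3⟩ := key x
    obtain ⟨v, hv1, hv2, hv3⟩ := key y
    refine ⟨⟨(u, v), ?_⟩, ?_⟩
    · simp only [Finset.mem_filter, Finset.mem_product, Finset.mem_Icc]
      refine ⟨⟨⟨hu1, hu2⟩, hv1, hv2⟩, ?_⟩
      rw [← ZMod.intCast_zmod_eq_zero_iff_dvd]
      push_cast
      rw [hu3, hv3]; exact hz
    · simp [hu3, hv3]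


section primebound

variable {p : ℕ} [hpf : Fact p.Prime]

lemma unit_of_red {k : ℕ} (hk : k ≠ 0) (u : ZMod (p ^ k))
    (h : ZMod.castHom (dvd_pow_self p hk) (ZMod p) u ≠ 0) : IsUnit u := by
  have : NeZero (p ^ k) := ⟨pow_ne_zero _ hpf.out.ne_zero⟩
  rw [← ZMod.natCast_zmod_val u] at h ⊢
  rw [map_natCast, Ne, ZMod.natCast_eq_zero_iff] at h
  rw [ZMod.isUnit_iff_coprime]
  exact Nat.Coprime.pow_right _ ((Nat.Prime.coprime_iff_not_dvd hpf.out).2 h).symm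

lemma red_ne_of_unit {k : ℕ} (hk : k ≠ 0) (u : ZMod (p ^ k)) (h : IsUnit u) :
    ZMod.castHom (dvd_pow_self p hk) (ZMod p) u ≠ 0 :=
  (h.map (ZMod.castHom (dvd_pow_self p hk) (ZMod p))).ne_zero

lemma sq_eq_units {k : ℕ} (hk : k ≠ 0) (hp2 : p ≠ 2) (x y : ZMod (p ^ k)) (hx : IsUnit x)
    (h : x ^ 2 = y ^ 2) : y = x ∨ y = -x := by
  have h0 : (x - y) * (x + y) = 0 := by linear_combination h
  by_cases h1 : ZMod.castHom (dvd_pow_self p hk) (ZMod p) (x - y) = 0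
  · by_cases h2 : ZMod.castHom (dvd_pow_self p hk) (ZMod p) (x + y) = 0
    · exfalso
      rw [map_sub] at h1
      rw [map_add] at h2
      have h3 : (2 : ZMod p) * ZMod.castHom (dvd_pow_self p hk) (ZMod p) x = 0 := by
        linear_combination h1 + h2
      rcases mul_eq_zero.1 h3 with h4 | h4
      · have : ((2 : ℕ) : ZMod p) = 0 := by exact_mod_cast h4
        rw [ZMod.natCast_eq_zero_iff] at this
        exact hp2 ((Nat.prime_dvd_prime_iff_eq hpf.out Nat.prime_two).1 this)
      · exact red_ne_of_unit hk x hx h4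
    · left
      have := (unit_of_red hk _ h2).mul_left_eq_zero.1 h0
      exact (sub_eq_zero.1 this).symm
  · right
    have := (unit_of_red hk _ h1).mul_right_eq_zero.1 h0
    exact (neg_eq_of_add_eq_zero_right this).symm

open Classical in
lemma fib_snd (hp2 : p ≠ 2) (S : Finset (ZMod (p ^ 2) × ZMod (p ^ 2)))
    (hS : ∀ z ∈ S, z.1 ^ 2 + z.2 ^ 2 + 1 = 0) (hu : ∀ z ∈ S, IsUnit z.2) :
    S.card ≤ 2 * (S.image Prod.fst).card := by
  apply Finset.card_le_mul_card_image
  intro a ha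
  obtain ⟨z0, hz0, rfl⟩ := Finset.mem_image.1 ha
  calc _ ≤ ({z0, (z0.1, -z0.2)} : Finset _).card := by
        apply Finset.card_le_card
        intro z hz
        rw [Finset.mem_filter] at hz
        have h1 := hS z hz.1
        have h2 := hS z0 hz0
        rw [hz.2] at h1
        rcases sq_eq_units two_ne_zero hp2 z0.2 z.2 (hu z0 hz0) (by linear_combination h2 - h1) with h | h
        · simp [Prod.ext_iff, hz.2, h]
        · simp [Prod.ext_iff, hz.2, h]
    _ ≤ 2 := Finset.card_le_two

open Classical in
lemma fib_fst (hp2 : p ≠ 2) (S : Finset (ZMod (p ^ 2) × ZMod (p ^ 2)))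
    (hS : ∀ z ∈ S, z.1 ^ 2 + z.2 ^ 2 + 1 = 0) (hu : ∀ z ∈ S, IsUnit z.1) :
    S.card ≤ 2 * (S.image Prod.snd).card := by
  have := fib_snd hp2 (S.image Prod.swap) (by
    intro z hz
    obtain ⟨w, hw, rfl⟩ := Finset.mem_image.1 hz
    have := hS w hw
    simp only [Prod.fst_swap, Prod.snd_swap]
    linear_combination this) (by
    intro z hz
    obtain ⟨w, hw, rfl⟩ := Finset.mem_image.1 hz
    exact hu w hw)
  rw [Finset.card_image_of_injective _ Prod.swap_injective, Finset.image_image] at this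
  exact this

lemma unit_or (z : ZMod (p ^ 2) × ZMod (p ^ 2)) (hz : z.1 ^ 2 + z.2 ^ 2 + 1 = 0) :
    IsUnit z.1 ∨ IsUnit z.2 := by
  by_contra hcon
  push Not at hcon
  have h1 : ZMod.castHom (dvd_pow_self p two_ne_zero) (ZMod p) z.1 = 0 := by
    by_contra h; exact hcon.1 (unit_of_red two_ne_zero _ h)
  have h2 : ZMod.castHom (dvd_pow_self p two_ne_zero) (ZMod p) z.2 = 0 := by
    by_contra h; exact hcon.2 (unit_of_red two_ne_zero _ h)
  have := congrArg (ZMod.castHom (dvd_pow_self p two_ne_zero) (ZMod p)) hz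
  simp only [map_add, map_pow, h1, h2, map_one, map_zero] at this
  norm_num at this

lemma red_zero (u : ZMod (p ^ 2)) (h : (p : ZMod (p ^ 2)) * u = 0) :
    ZMod.castHom (dvd_pow_self p two_ne_zero) (ZMod p) u = 0 := by
  have : NeZero (p ^ 2) := ⟨pow_ne_zero _ hpf.out.ne_zero⟩
  rw [← ZMod.natCast_zmod_val u] at h ⊢
  rw [map_natCast, ZMod.natCast_eq_zero_iff]
  rw [← Nat.cast_mul, ZMod.natCast_eq_zero_iff] at h
  have h' : p * p ∣ p * u.val := by simpa only [pow_two] using h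
  exact Nat.dvd_of_mul_dvd_mul_left hpf.out.pos h'

open Classical in
lemma red_fib [NeZero (p ^ 2)] (v : ZMod p) :
    ((Finset.univ : Finset (ZMod (p ^ 2))).filter
      (fun u => ZMod.castHom (dvd_pow_self p two_ne_zero) (ZMod p) u = v)).card ≤ p := by
  calc _ ≤ (Finset.range p).card := by
        apply Finset.card_le_card_of_injOn (fun u => u.val / p)
        · intro u hu
          simp only [Finset.coe_range, Set.mem_Iio]
          apply Nat.div_lt_of_lt_mul
          rw [← pow_two]; exact ZMod.val_lt u
        · intro u hu w hw huw
          simp only [Finset.coe_filter, Finset.mem_univ, true_and, Set.mem_ofPred_eq] at hu hw huw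
          have h1 := hu.trans hw.symm
          rw [← ZMod.natCast_zmod_val u, ← ZMod.natCast_zmod_val w, map_natCast, map_natCast,
            ZMod.natCast_eq_natCast_iff] at h1
          apply ZMod.val_injective
          rw [← Nat.div_add_mod u.val p, ← Nat.div_add_mod w.val p, huw, h1]
    _ = p := by simp

lemma Bc_swap (q d : ℕ) (m n : ℤ) : Bc q d m n = Bc q d n m := by
  unfold Bc
  apply Nat.card_congr
  refine ⟨fun z => ⟨z.1.swap, ?_, ?_⟩, fun z => ⟨z.1.swap, ?_, ?_⟩, ?_, ?_⟩
  · have := z.2.1; simp only [Prod.fst_swap, Prod.snd_swap]; linear_combination this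
  · have := z.2.2; simp only [Prod.fst_swap, Prod.snd_swap]; linear_combination -this
  · have := z.2.1; simp only [Prod.fst_swap, Prod.snd_swap]; linear_combination this
  · have := z.2.2; simp only [Prod.fst_swap, Prod.snd_swap]; linear_combination -this
  · intro z; simp
  · intro z; simp

lemma Bc_two (m n : ℤ) : Bc (2 ^ 2) 2 m n = 0 := by
  unfold Bc
  have key : ∀ x y : ZMod (2 ^ 2), x ^ 2 + y ^ 2 + 1 ≠ 0 := by decide
  have : IsEmpty {z : ZMod (2 ^ 2) × ZMod (2 ^ 2) // z.1 ^ 2 + z.2 ^ 2 + 1 = 0 ∧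
    ((2 : ℕ) : ZMod (2 ^ 2)) * ((m : ZMod (2 ^ 2)) * z.2 - (n : ZMod (2 ^ 2)) * z.1) = 0} :=
    ⟨fun z => key _ _ z.2.1⟩
  exact Nat.card_of_isEmpty

open Classical in
lemma Bc_prime_triv (hp2 : p ≠ 2) (m n : ℤ) : Bc (p ^ 2) p m n ≤ 4 * p * p := by
  have : NeZero (p ^ 2) := ⟨pow_ne_zero _ hpf.out.ne_zero⟩
  unfold Bc
  rw [Nat.card_eq_fintype_card, Fintype.card_subtype]
  set S := (Finset.univ : Finset (ZMod (p ^ 2) × ZMod (p ^ 2))).filter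
    (fun z => z.1 ^ 2 + z.2 ^ 2 + 1 = 0) with hS
  have h1 := fib_fst hp2 (S.filter (fun z => IsUnit z.1)) (by intro z hz; simp [S] at hz; exact hz.1)
    (by intro z hz; simp at hz; exact hz.2)
  have h2 := fib_snd hp2 (S.filter (fun z => IsUnit z.2)) (by intro z hz; simp [S] at hz; exact hz.1)
    (by intro z hz; simp at hz; exact hz.2)
  have h3 : ∀ s : Finset (ZMod (p ^ 2)), s.card ≤ p * p := by
    intro s
    refine (Finset.card_le_univ s).trans ?_
    rw [ZMod.card, pow_two]
  calc _ ≤ (S.filter (fun z => IsUnit z.1) ∪ S.filter (fun z => IsUnit z.2)).card := by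
        apply Finset.card_le_card
        intro z hz
        simp only [Finset.mem_filter, Finset.mem_univ, true_and, Finset.mem_union, S] at hz ⊢
        rcases unit_or z hz.1 with h | h
        · exact Or.inl ⟨hz.1, h⟩
        · exact Or.inr ⟨hz.1, h⟩
    _ ≤ _ := Finset.card_union_le _ _
    _ ≤ 2 * (p * p) + 2 * (p * p) := by
        gcongr
        · exact h1.trans (by gcongr; apply h3)
        · exact h2.trans (by gcongr; apply h3)
    _ = _ := by ring

open Classical in
lemma Bc_prime_good (hp2 : p ≠ 2) (m n : ℤ) (hm : ¬ (p : ℤ) ∣ m) : Bc (p ^ 2) p m n ≤ 4 * p := by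
  have : NeZero (p ^ 2) := ⟨pow_ne_zero _ hpf.out.ne_zero⟩
  have hm' : (m : ZMod p) ≠ 0 := by
    rwa [Ne, ZMod.intCast_zmod_eq_zero_iff_dvd]
  unfold Bc
  rw [Nat.card_eq_fintype_card, Fintype.card_subtype]
  set S := (Finset.univ : Finset (ZMod (p ^ 2) × ZMod (p ^ 2))).filter
    (fun z => z.1 ^ 2 + z.2 ^ 2 + 1 = 0 ∧
    (p : ZMod (p ^ 2)) * ((m : ZMod (p ^ 2)) * z.2 - (n : ZMod (p ^ 2)) * z.1) = 0) with hS
  set π := ZMod.castHom (dvd_pow_self p two_ne_zero) (ZMod p) with hπ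
  have hmem : ∀ z ∈ S, z.1 ^ 2 + z.2 ^ 2 + 1 = 0 ∧ π z.1 ^ 2 + π z.2 ^ 2 + 1 = 0 ∧
      (m : ZMod p) * π z.2 = n * π z.1 := by
    intro z hz
    simp only [Finset.mem_filter, Finset.mem_univ, true_and, S] at hz
    refine ⟨hz.1, by simpa using congrArg π hz.1, ?_⟩
    have := red_zero _ hz.2
    simp only [map_sub, map_mul, map_intCast] at this
    exact sub_eq_zero.1 this
  have hu : ∀ z ∈ S, IsUnit z.1 := by
    intro z hz
    obtain ⟨-, h1, h2⟩ := hmem z hz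
    apply unit_of_red two_ne_zero
    intro h3
    change π z.1 = 0 at h3
    rw [h3, mul_zero] at h2
    have h4 : π z.2 = 0 := (mul_eq_zero.1 h2).resolve_left hm'
    rw [h3, h4] at h1
    norm_num at h1
  have hA := fib_fst hp2 S (fun z hz => (hmem z hz).1) hu
  have hB : (S.image Prod.snd).card ≤ p * ((S.image Prod.snd).image π).card := by
    apply Finset.card_le_mul_card_image
    intro a ha
    exact (Finset.card_le_card (Finset.filter_subset_filter _ (Finset.subset_univ _))).trans (red_fib a)
  have hC : ((S.image Prod.snd).image π).card ≤ 2 := by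
    rcases ((S.image Prod.snd).image π).eq_empty_or_nonempty with h | ⟨v, hv⟩
    · rw [h]; simp
    · have key : ∀ v ∈ ((S.image Prod.snd).image π), ((m : ZMod p) ^ 2 + n ^ 2) * v ^ 2 = - n ^ 2 := by
        intro v hv
        rw [Finset.image_image] at hv
        obtain ⟨z, hz, rfl⟩ := Finset.mem_image.1 hv
        obtain ⟨-, h1, h2⟩ := hmem z hz
        simp only [Function.comp_apply]
        linear_combination ((m : ZMod p) * π z.2 + n * π z.1) * h2 + (n : ZMod p) ^ 2 * h1
      have hne : ((m : ZMod p) ^ 2 + n ^ 2) ≠ 0 := by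
        intro h
        have h1 := key v hv
        rw [h, zero_mul] at h1
        apply hm'
        have : (m : ZMod p) ^ 2 = 0 := by linear_combination h - h1
        exact pow_eq_zero_iff two_ne_zero |>.1 this
      calc _ ≤ ({v, -v} : Finset (ZMod p)).card := by
            apply Finset.card_le_card
            intro w hw
            have h1 := key v hv
            have h2 := key w hw
            have h3 : w ^ 2 = v ^ 2 := mul_left_cancel₀ hne (h2.trans h1.symm)
            rcases sq_eq_sq_iff_eq_or_eq_neg.1 h3 with h | h <;> simp [h]
        _ ≤ 2 := Finset.card_le_two
  calc S.card ≤ 2 * (p * 2) := hA.trans (by gcongr; exact hB.trans (by gcongr))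
    _ = _ := by ring

lemma Bc_prime (m n : ℤ) : Bc (p ^ 2) p m n ≤ 4 * p * (Int.gcd p (Int.gcd m n)) := by
  by_cases hp2 : p = 2
  · subst hp2
    rw [Bc_two]; exact Nat.zero_le _
  have hg : Int.gcd p (Int.gcd m n) = 1 ∨ Int.gcd p (Int.gcd m n) = p := by
    apply (Nat.dvd_prime hpf.out).1
    have := Int.gcd_dvd_left (p : ℤ) (Int.gcd m n)
    exact_mod_cast this
  rcases hg with hg | hg
  · rw [hg, mul_one]
    by_cases hm : (p : ℤ) ∣ m
    · by_cases hn : (p : ℤ) ∣ n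
      · exfalso
        have h1 : (p : ℤ) ∣ Int.gcd m n := Int.dvd_coe_gcd hm hn
        have h2 : (p : ℤ) ∣ Int.gcd p (Int.gcd m n) := Int.dvd_coe_gcd dvd_rfl h1
        rw [hg] at h2
        have h3 : p ∣ 1 := by exact_mod_cast h2
        exact hpf.out.one_lt.ne' (Nat.dvd_one.1 h3)
      · rw [Bc_swap]; exact Bc_prime_good hp2 n m hn
    · exact Bc_prime_good hp2 m n hm
  · rw [hg]; exact Bc_prime_triv hp2 m n

end primebound

lemma Bc_bound (m n : ℤ) (d : ℕ) (hd : Squarefree d) :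
    Bc (d ^ 2) d m n ≤ d.divisors.card ^ 2 * d * (Int.gcd d (Int.gcd m n)) := by
  induction d using Nat.recOnPosPrimePosCoprime with
  | prime_pow p k hp hk =>
    have : Fact p.Prime := ⟨hp⟩
    have hk1 : k = 1 := by
      rcases (Nat.squarefree_pow_iff hp.one_lt.ne' hk.ne').1 hd with ⟨-, h⟩
      exact h
    subst hk1
    rw [pow_one, Nat.Prime.divisors hp, Finset.card_pair hp.one_lt.ne]
    exact Bc_prime m n
  | zero => exact absurd hd not_squarefree_zero
  | one =>
    simp only [one_pow, Nat.divisors_one, Finset.card_singleton, mul_one, Nat.cast_one, Int.one_gcd]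
    unfold Bc
    have : Subsingleton (ZMod 1) := inferInstance
    exact Finite.card_le_one_iff_subsingleton.2 inferInstance
  | coprime a b ha hb hab iha ihb =>
    have h1 := iha (hd.squarefree_of_dvd (dvd_mul_right _ _))
    have h2 := ihb (hd.squarefree_of_dvd (dvd_mul_left _ _))
    refine (Bc_mul a b (by omega) (by omega) hab m n).trans ?_
    refine (Nat.mul_le_mul h1 h2).trans (le_of_eq ?_)
    have e : Int.gcd ((a * b : ℕ) : ℤ) (Int.gcd m n) = Int.gcd a (Int.gcd m n) * Int.gcd b (Int.gcd m n) := by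
      simp only [Int.gcd_natCast_natCast]
      exact Nat.Coprime.mul_gcd hab _
    rw [e, Nat.Coprime.card_divisors_mul hab]
    ring


lemma rc_le (n : ℕ) (hn : 0 < n) : rc n ≤ n.divisors.card := by
  classical
  induction n using Nat.recOnPosPrimePosCoprime with
  | prime_pow p k hp hk =>
    have : Fact p.Prime := ⟨hp⟩
    have hk0 : k ≠ 0 := hk.ne'
    have : NeZero (p ^ k) := ⟨pow_ne_zero _ hp.ne_zero⟩
    rw [Nat.divisors_prime_pow hp, Finset.card_map, Finset.card_range]
    have h2k : 2 ≤ k + 1 := by omega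
    refine le_trans ?_ h2k
    unfold rc
    by_cases hp2 : p = 2
    · subst hp2
      by_cases hk1 : k = 1
      · subst hk1
        rw [Nat.card_eq_fintype_card]
        refine (Fintype.card_subtype_le _).trans ?_
        rw [ZMod.card, pow_one]
      · have key : ∀ x : ZMod 4, x ^ 2 + 1 ≠ 0 := by decide
        have hd : 4 ∣ 2 ^ k := by
          have := pow_dvd_pow 2 (show 2 ≤ k by omega)
          simpa using this
        have : IsEmpty {s : ZMod (2 ^ k) // s ^ 2 + 1 = 0} := by
          refine ⟨fun z => ?_⟩
          have := congrArg (ZMod.castHom hd (ZMod 4)) z.2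
          simp only [map_add, map_pow, map_one, map_zero] at this
          exact key _ this
        rw [Nat.card_of_isEmpty]; exact Nat.zero_le _
    · rw [Nat.card_eq_fintype_card, Fintype.card_subtype]
      rcases ((Finset.univ : Finset (ZMod (p ^ k))).filter (fun s => s ^ 2 + 1 = 0)).eq_empty_or_nonempty with h | ⟨v, hv⟩
      · rw [h]; simp
      · calc _ ≤ ({v, -v} : Finset (ZMod (p ^ k))).card := by
              apply Finset.card_le_card
              intro w hw
              simp only [Finset.mem_filter, Finset.mem_univ, true_and] at hv hw
              have hu : IsUnit v := IsUnit.of_mul_eq_one (-v) (by linear_combination -hv)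
              rcases sq_eq_units hk0 hp2 v w hu (by linear_combination hv - hw) with h | h <;> simp [h]
          _ ≤ 2 := Finset.card_le_two
  | zero => omega
  | one =>
    simp only [Nat.divisors_one, Finset.card_singleton]
    unfold rc
    have : Subsingleton (ZMod 1) := inferInstance
    exact Finite.card_le_one_iff_subsingleton.2 inferInstance
  | coprime a b ha hb hab iha ihb =>
    refine (rc_mul a b (by omega) (by omega) hab).trans ?_
    rw [Nat.Coprime.card_divisors_mul hab]
    exact Nat.mul_le_mul (iha (by omega)) (ihb (by omega))

/-- positive representations as a sum of two squares -/
def r2 (n : ℕ) : Finset (ℕ × ℕ) :=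
  (Finset.Icc 1 n ×ˢ Finset.Icc 1 n).filter (fun z => z.1 ^ 2 + z.2 ^ 2 = n)

lemma mem_r2 (n : ℕ) (z : ℕ × ℕ) : z ∈ r2 n ↔ 1 ≤ z.1 ∧ 1 ≤ z.2 ∧ z.1 ^ 2 + z.2 ^ 2 = n := by
  unfold r2
  simp only [Finset.mem_filter, Finset.mem_product, Finset.mem_Icc]
  constructor
  · rintro ⟨⟨⟨a, b⟩, c, d⟩, e⟩; exact ⟨a, c, e⟩
  · rintro ⟨a, c, e⟩
    refine ⟨⟨⟨a, ?_⟩, c, ?_⟩, e⟩ <;> nlinarith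

lemma r2_prim (n : ℕ) (hn : 0 < n) :
    ((r2 n).filter (fun z => Nat.Coprime z.1 z.2)).card ≤ rc n := by
  classical
  have : NeZero n := ⟨hn.ne'⟩
  unfold rc
  rw [← Nat.card_eq_finsetCard]
  have hcop : ∀ z ∈ (r2 n).filter (fun z => Nat.Coprime z.1 z.2), IsUnit ((z.2 : ℕ) : ZMod n) := by
    intro z hz
    rw [Finset.mem_filter, mem_r2] at hz
    rw [ZMod.isUnit_iff_coprime, ← hz.1.2.2]
    have : Nat.Coprime z.2 (z.1 ^ 2) := Nat.Coprime.pow_right 2 hz.2.symm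
    rw [pow_two z.2]
    exact (Nat.coprime_add_mul_left_right _ _ _).2 this
  refine Nat.card_le_card_of_injective
    (fun z => ⟨((z.1.1 : ℕ) : ZMod n) * ((z.1.2 : ℕ) : ZMod n)⁻¹, ?_⟩) ?_
  · have hu := hcop z.1 z.2
    have hz := z.2
    rw [Finset.mem_filter, mem_r2] at hz
    have h1 : ((z.1.1 : ℕ) : ZMod n) ^ 2 + ((z.1.2 : ℕ) : ZMod n) ^ 2 = 0 := by
      have := congrArg (fun t : ℕ => (t : ZMod n)) hz.1.2.2
      simpa using this
    have h2 := ZMod.mul_inv_of_unit _ hu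
    linear_combination (((z.1.2 : ℕ) : ZMod n)⁻¹) ^ 2 * h1 -
      (((z.1.2 : ℕ) : ZMod n) * ((z.1.2 : ℕ) : ZMod n)⁻¹ + 1) * h2
  · rintro ⟨⟨x, y⟩, hz⟩ ⟨⟨x', y'⟩, hz'⟩ hh
    have hu := hcop _ hz
    have hu' := hcop _ hz'
    rw [Finset.mem_filter, mem_r2] at hz hz'
    simp only [Subtype.mk.injEq, Prod.mk.injEq] at hh hz hz' hu hu' ⊢
    have h2 := ZMod.mul_inv_of_unit _ hu
    have h2' := ZMod.mul_inv_of_unit _ hu'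
    have h3 : ((x * y' : ℕ) : ZMod n) = ((x' * y : ℕ) : ZMod n) := by
      push_cast
      linear_combination (y : ZMod n) * (y' : ZMod n) * hh - (x : ZMod n) * y' * h2 + (x' : ZMod n) * y * h2'
    rw [ZMod.natCast_eq_natCast_iff] at h3
    obtain ⟨⟨a1, a2, a3⟩, a4⟩ := hz
    obtain ⟨⟨b1, b2, b3⟩, b4⟩ := hz'
    have h4 : x * y' < n := by nlinarith [sq_nonneg ((x : ℤ) - y'), (Nat.pow_pos (n := 2) a1), two_mul_le_add_sq x y']
    have h5 : x' * y < n := by nlinarith [two_mul_le_add_sq x' y]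
    have h6 : x * y' = x' * y := Nat.ModEq.eq_of_lt_of_lt h3 h4 h5
    have d1 : x ∣ x' := a4.dvd_of_dvd_mul_right (Dvd.intro _ h6)
    have d2 : x' ∣ x := b4.dvd_of_dvd_mul_right (Dvd.intro _ h6.symm)
    have e1 := Nat.dvd_antisymm d1 d2
    subst e1
    exact ⟨rfl, (Nat.eq_of_mul_eq_mul_left (by omega) h6).symm⟩

lemma r2_le (n : ℕ) (hn : 0 < n) : (r2 n).card ≤ n.divisors.card ^ 2 := by
  classical
  rw [pow_two]
  have hmaps : ∀ z ∈ r2 n, Nat.gcd z.1 z.2 ∈ n.divisors := by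
    intro z hz
    rw [mem_r2] at hz
    rw [Nat.mem_divisors]
    refine ⟨?_, hn.ne'⟩
    rw [← hz.2.2]
    exact dvd_add ((Nat.gcd_dvd_left _ _).trans (dvd_pow_self _ two_ne_zero))
      ((Nat.gcd_dvd_right _ _).trans (dvd_pow_self _ two_ne_zero))
  refine Finset.card_le_mul_card_image_of_maps_to hmaps _ ?_
  intro g hg
  have hg0 : 0 < g := Nat.pos_of_mem_divisors hg
  rcases ((r2 n).filter (fun z => Nat.gcd z.1 z.2 = g)).eq_empty_or_nonempty with h | ⟨z0, hz0⟩
  · rw [h]; simp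
  · rw [Finset.mem_filter, mem_r2] at hz0
    obtain ⟨⟨a1, a2, a3⟩, a4⟩ := hz0
    have hgn : g ^ 2 ∣ n := by
      rw [← a3, ← a4]
      exact dvd_add (pow_dvd_pow_of_dvd (Nat.gcd_dvd_left _ _) 2)
        (pow_dvd_pow_of_dvd (Nat.gcd_dvd_right _ _) 2)
    obtain ⟨k, hk⟩ := hgn
    have hk0 : 0 < k := by
      rcases Nat.eq_zero_or_pos k with h | h
      · subst h; omega
      · exact h
    have hkn : k ∣ n := ⟨g ^ 2, by rw [hk]; ring⟩
    calc _ ≤ ((r2 k).filter (fun z => Nat.Coprime z.1 z.2)).card := by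
          apply Finset.card_le_card_of_injOn (fun z => (z.1 / g, z.2 / g))
          · intro z hz
            simp only [Finset.coe_filter, Set.mem_ofPred_eq, mem_r2] at hz ⊢
            obtain ⟨⟨b1, b2, b3⟩, b4⟩ := hz
            obtain ⟨u, hu⟩ : g ∣ z.1 := b4 ▸ Nat.gcd_dvd_left _ _
            obtain ⟨v, hv⟩ : g ∣ z.2 := b4 ▸ Nat.gcd_dvd_right _ _
            have e1 : z.1 / g = u := by rw [hu]; exact Nat.mul_div_cancel_left _ hg0
            have e2 : z.2 / g = v := by rw [hv]; exact Nat.mul_div_cancel_left _ hg0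
            rw [e1, e2]
            refine ⟨⟨?_, ?_, ?_⟩, ?_⟩
            · rcases Nat.eq_zero_or_pos u with h | h
              · subst h; omega
              · exact h
            · rcases Nat.eq_zero_or_pos v with h | h
              · subst h; omega
              · exact h
            · apply Nat.eq_of_mul_eq_mul_left (pow_pos hg0 2)
              rw [← hk, ← b3, hu, hv]; ring
            · rw [← e1, ← e2, ← b4]
              apply Nat.coprime_div_gcd_div_gcd
              rw [b4]; exact hg0
          · intro z hz w hw hzw
            simp only [Finset.coe_filter, Set.mem_ofPred_eq, mem_r2] at hz hw
            simp only [Prod.mk.injEq] at hzw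
            have q1 : g ∣ z.1 := hz.2 ▸ Nat.gcd_dvd_left _ _
            have q2 : g ∣ z.2 := hz.2 ▸ Nat.gcd_dvd_right _ _
            have q3 : g ∣ w.1 := hw.2 ▸ Nat.gcd_dvd_left _ _
            have q4 : g ∣ w.2 := hw.2 ▸ Nat.gcd_dvd_right _ _
            refine Prod.ext ?_ ?_
            · rw [← Nat.div_mul_cancel q1, ← Nat.div_mul_cancel q3, hzw.1]
            · rw [← Nat.div_mul_cancel q2, ← Nat.div_mul_cancel q4, hzw.2]
      _ ≤ rc k := r2_prim k hk0
      _ ≤ k.divisors.card := rc_le k hk0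
      _ ≤ _ := Finset.card_le_card (Nat.divisors_subset_of_dvd hn.ne' hkn)


/-- pairs in the box with q ∣ x² + y² + 1 -/
def Nc (H q : ℕ) : ℕ :=
  ((Finset.Icc 1 H ×ˢ Finset.Icc 1 H).filter
    (fun p : ℕ × ℕ => q ∣ p.1 ^ 2 + p.2 ^ 2 + 1)).card

section fourier

variable {q : ℕ} [NeZero q]

/-- solutions mod q -/
def Tset (q : ℕ) [NeZero q] : Finset (ZMod q × ZMod q) :=
  Finset.univ.filter (fun z => z.1 ^ 2 + z.2 ^ 2 + 1 = 0)

noncomputable def Esum (m n : ZMod q) : ℂ :=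
  ∑ z ∈ Tset q, ZMod.stdAddChar (m * z.1 + n * z.2)

noncomputable def Fsum (H : ℕ) (m : ZMod q) : ℂ :=
  ∑ h ∈ Finset.Icc 1 H, ZMod.stdAddChar (-(m * (h : ZMod q)))

lemma Tset_card : (Tset q).card = lc q := by
  unfold Tset lc
  rw [Nat.card_eq_fintype_card, Fintype.card_subtype]

lemma fourier_identity (H : ℕ) :
    (q : ℂ) ^ 2 * (Nc H q : ℂ) = ∑ m : ZMod q, ∑ n : ZMod q, Fsum H m * Fsum H n * Esum m n := by
  have hprim := ZMod.isPrimitive_stdAddChar q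
  have key : ∀ m n : ZMod q, Fsum H m * Fsum H n * Esum m n =
      ∑ x ∈ Finset.Icc 1 H, ∑ y ∈ Finset.Icc 1 H, ∑ z ∈ Tset q,
        ZMod.stdAddChar (m * (z.1 - (x : ZMod q))) * ZMod.stdAddChar (n * (z.2 - (y : ZMod q))) := by
    intro m n
    unfold Fsum Esum
    rw [Finset.sum_mul_sum, Finset.sum_mul]
    refine Finset.sum_congr rfl fun x _ => ?_
    rw [Finset.sum_mul]
    refine Finset.sum_congr rfl fun y _ => ?_
    rw [Finset.mul_sum]
    refine Finset.sum_congr rfl fun z _ => ?_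
    rw [← AddChar.map_add_eq_mul, ← AddChar.map_add_eq_mul, ← AddChar.map_add_eq_mul]
    congr 1; ring
  have h1 : ∀ b : ZMod q, ∑ m : ZMod q, (ZMod.stdAddChar (m * b) : ℂ) = if b = 0 then (q : ℂ) else 0 := by
    intro b
    have := AddChar.sum_mulShift b hprim
    rw [ZMod.card] at this
    rw [this]; split_ifs <;> simp
  calc (q : ℂ) ^ 2 * (Nc H q : ℂ)
      = ∑ x ∈ Finset.Icc 1 H, ∑ y ∈ Finset.Icc 1 H, ∑ z ∈ Tset q,
        (if z.1 - (x : ZMod q) = 0 then (q : ℂ) else 0) * (if z.2 - (y : ZMod q) = 0 then (q : ℂ) else 0) := by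
        have : ∀ x y : ℕ, ∑ z ∈ Tset q,
          (if z.1 - (x : ZMod q) = 0 then (q : ℂ) else 0) * (if z.2 - (y : ZMod q) = 0 then (q : ℂ) else 0)
          = (q : ℂ) ^ 2 * (if q ∣ x ^ 2 + y ^ 2 + 1 then 1 else 0) := by
          intro x y
          have e : ∀ z : ZMod q × ZMod q, (if z.1 - (x : ZMod q) = 0 then (q : ℂ) else 0) * (if z.2 - (y : ZMod q) = 0 then (q : ℂ) else 0)
             = if z = ((x : ZMod q), (y : ZMod q)) then (q : ℂ) ^ 2 else 0 := by
            intro z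
            simp only [Prod.ext_iff, sub_eq_zero]
            by_cases a : z.1 = x <;> by_cases b : z.2 = y <;> simp [a, b, pow_two]
          simp_rw [e]
          rw [Finset.sum_ite_eq']
          have : ((x : ZMod q), (y : ZMod q)) ∈ Tset q ↔ q ∣ x ^ 2 + y ^ 2 + 1 := by
            unfold Tset
            rw [Finset.mem_filter, ← ZMod.natCast_eq_zero_iff]
            push_cast
            simp
          simp only [this]
          split_ifs <;> simp
        simp_rw [this]
        simp_rw [← Finset.mul_sum]
        congr 1
        unfold Nc
        rw [Finset.card_filter, Finset.sum_product]
        push_cast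
        rfl
    _ = ∑ x ∈ Finset.Icc 1 H, ∑ y ∈ Finset.Icc 1 H, ∑ z ∈ Tset q,
        ∑ m : ZMod q, ∑ n : ZMod q, ZMod.stdAddChar (m * (z.1 - (x : ZMod q))) * ZMod.stdAddChar (n * (z.2 - (y : ZMod q))) := by
        refine Finset.sum_congr rfl fun x _ => Finset.sum_congr rfl fun y _ =>
          Finset.sum_congr rfl fun z _ => ?_
        rw [← Finset.sum_mul_sum, h1, h1]
    _ = _ := by
        simp_rw [key]
        have c := Finset.sum_comm (s := Finset.Icc 1 H ×ˢ Finset.Icc 1 H ×ˢ Tset q)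
          (t := (Finset.univ : Finset (ZMod q)) ×ˢ (Finset.univ : Finset (ZMod q)))
          (f := fun a b => (ZMod.stdAddChar (b.1 * (a.2.2.1 - (a.1 : ZMod q))) : ℂ) *
            ZMod.stdAddChar (b.2 * (a.2.2.2 - (a.2.1 : ZMod q))))
        simp only [Finset.sum_product] at c
        exact c

lemma Esum_bound (d : ℕ) (hq : q = d ^ 2) (m n : ZMod q) :
    ‖Esum m n‖ ≤ Bc q d (m.val : ℤ) (n.val : ℤ) := by
  have hprim := ZMod.isPrimitive_stdAddChar q
  have hd0 : (d : ZMod q) ^ 2 = 0 := by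
    rw [← Nat.cast_pow, ← hq]; exact ZMod.natCast_self q
  have hshift : ∀ t : ZMod q, Esum m n =
      ∑ z ∈ Tset q, ZMod.stdAddChar (m * z.1 + n * z.2) * ZMod.stdAddChar (t * ((d : ZMod q) * (m * z.2 - n * z.1))) := by
    intro t
    unfold Esum
    refine Finset.sum_nbij' (fun z => (z.1 - d * t * z.2, z.2 + d * t * z.1))
      (fun z => (z.1 + d * t * z.2, z.2 - d * t * z.1)) ?_ ?_ ?_ ?_ ?_
    · intro z hz
      simp only [Tset, Finset.mem_filter, Finset.mem_univ, true_and] at hz ⊢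
      linear_combination hz + t ^ 2 * (z.1 ^ 2 + z.2 ^ 2) * hd0
    · intro z hz
      simp only [Tset, Finset.mem_filter, Finset.mem_univ, true_and] at hz ⊢
      linear_combination hz + t ^ 2 * (z.1 ^ 2 + z.2 ^ 2) * hd0
    · intro z hz
      refine Prod.ext ?_ ?_
      · simp only; linear_combination t ^ 2 * z.1 * hd0
      · simp only; linear_combination t ^ 2 * z.2 * hd0
    · intro z hz
      refine Prod.ext ?_ ?_
      · simp only; linear_combination t ^ 2 * z.1 * hd0
      · simp only; linear_combination t ^ 2 * z.2 * hd0
    · intro z hz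
      rw [← AddChar.map_add_eq_mul]
      congr 1
      simp only
      linear_combination (-t ^ 2 * (m * z.1 + n * z.2)) * hd0
  have hq0 : (q : ℂ) ≠ 0 := Nat.cast_ne_zero.2 (NeZero.ne q)
  have h2 : (q : ℂ) * Esum m n = (q : ℂ) * ∑ z ∈ Tset q,
      if (d * (m * z.2 - n * z.1) : ZMod q) = 0 then (ZMod.stdAddChar (m * z.1 + n * z.2) : ℂ) else 0 := by
    calc (q : ℂ) * Esum m n = ∑ t : ZMod q, Esum m n := by
          rw [Finset.sum_const, Finset.card_univ, ZMod.card, nsmul_eq_mul]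
      _ = ∑ t : ZMod q, ∑ z ∈ Tset q, ZMod.stdAddChar (m * z.1 + n * z.2) * ZMod.stdAddChar (t * ((d : ZMod q) * (m * z.2 - n * z.1))) :=
          Finset.sum_congr rfl fun t _ => hshift t
      _ = _ := by
          rw [Finset.sum_comm, Finset.mul_sum]
          refine Finset.sum_congr rfl fun z _ => ?_
          rw [← Finset.mul_sum, AddChar.sum_mulShift _ hprim, ZMod.card]
          split_ifs <;> simp [mul_comm]
  rw [mul_left_cancel₀ hq0 h2, ← Finset.sum_filter]
  refine (norm_sum_le _ _).trans ?_
  have h3 : ∀ u : ZMod q, ‖(ZMod.stdAddChar u : ℂ)‖ = 1 := fun u => by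
    rw [ZMod.stdAddChar_apply]; exact Circle.norm_coe _
  simp_rw [h3]
  rw [Finset.sum_const, nsmul_eq_mul, mul_one]
  apply le_of_eq
  congr 1
  unfold Bc Tset
  rw [Nat.card_eq_fintype_card, Fintype.card_subtype, Finset.filter_filter]
  congr 1
  ext z
  simp

lemma Fsum_zero (H : ℕ) : ‖Fsum H (0 : ZMod q)‖ = H := by
  unfold Fsum; simp

lemma Fsum_bound (H : ℕ) (m : ZMod q) (hm : m ≠ 0) :
    ‖Fsum H m‖ ≤ (q : ℝ) / 2 * (1 / (m.val : ℝ) + 1 / ((q : ℝ) - m.val)) := by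
  set w : ℂ := ZMod.stdAddChar (-m) with hw
  have hw1 : ‖w‖ = 1 := by rw [hw, ZMod.stdAddChar_apply]; exact Circle.norm_coe _
  have hF : Fsum H m = ∑ h ∈ Finset.Icc 1 H, w ^ h := by
    unfold Fsum
    refine Finset.sum_congr rfl fun h _ => ?_
    rw [hw, ← AddChar.map_nsmul_eq_pow]
    congr 1
    rw [nsmul_eq_mul]; ring
  have hv0 : 0 < m.val := Nat.pos_of_ne_zero (by rwa [Ne, ZMod.val_eq_zero])
  have hvq : m.val < q := ZMod.val_lt m
  set v := m.val with hv
  have hv0' : (0 : ℝ) < v := by exact_mod_cast hv0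
  have hvq' : (v : ℝ) < q := by exact_mod_cast hvq
  have hq0 : (0 : ℝ) < q := hv0'.trans hvq'
  have hnorm : ‖w - 1‖ = 2 * |Real.sin (Real.pi * (v / q))| := by
    have : w = Complex.exp (Complex.I * ((-(2 * Real.pi * (v / q)) : ℝ) : ℂ)) := by
      rw [hw, show (-m : ZMod q) = ((-(v : ℤ) : ℤ) : ZMod q) by simp [hv], ZMod.stdAddChar_coe]
      congr 1
      push_cast; ring
    rw [this, Complex.norm_exp_I_mul_ofReal_sub_one, norm_mul, Real.norm_eq_abs, Real.norm_eq_abs,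
      abs_two, show -(2 * Real.pi * (v / q : ℝ)) / 2 = -(Real.pi * (v / q)) by ring, Real.sin_neg, abs_neg]
  have hs0 : 0 < (v / q : ℝ) := by positivity
  have hs1 : (v / q : ℝ) < 1 := by rw [div_lt_one hq0]; exact hvq'
  have hG : (q : ℝ) / 2 * (1 / (v : ℝ) + 1 / ((q : ℝ) - v)) = 1 / (2 * (v / q : ℝ)) + 1 / (2 * (1 - (v / q : ℝ))) := by
    have : (q : ℝ) - v ≠ 0 := by linarith
    have : 1 - (v / q : ℝ) ≠ 0 := by linarith
    field_simp
  rw [hG]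
  set s : ℝ := v / q with hs
  have hsin : 1 / |Real.sin (Real.pi * s)| ≤ 1 / (2 * s) + 1 / (2 * (1 - s)) := by
    have pp := Real.pi_pos
    have a1 : 0 < 1 / (2 * s) := by positivity
    have a2 : 0 < 1 / (2 * (1 - s)) := by
      have : 0 < 1 - s := by linarith
      positivity
    rcases le_total s (1 / 2) with h | h
    · have h1 : 2 / Real.pi * (Real.pi * s) ≤ Real.sin (Real.pi * s) :=
        Real.mul_le_sin (by positivity) (by nlinarith)
      have h2 : 2 / Real.pi * (Real.pi * s) = 2 * s := by field_simp
      rw [h2] at h1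
      have h3 : 1 / |Real.sin (Real.pi * s)| ≤ 1 / (2 * s) := by
        apply one_div_le_one_div_of_le (by positivity)
        exact h1.trans (le_abs_self _)
      linarith
    · have h1 : 2 / Real.pi * (Real.pi * (1 - s)) ≤ Real.sin (Real.pi * (1 - s)) :=
        Real.mul_le_sin (mul_nonneg pp.le (by linarith)) (by nlinarith)
      have h2 : 2 / Real.pi * (Real.pi * (1 - s)) = 2 * (1 - s) := by field_simp
      rw [h2, show Real.pi * (1 - s) = Real.pi - Real.pi * s by ring, Real.sin_pi_sub] at h1
      have h3 : 1 / |Real.sin (Real.pi * s)| ≤ 1 / (2 * (1 - s)) := by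
        apply one_div_le_one_div_of_le (by linarith)
        exact h1.trans (le_abs_self _)
      linarith
  refine le_trans ?_ hsin
  have hsinpos : 0 < Real.sin (Real.pi * s) :=
    Real.sin_pos_of_pos_of_lt_pi (by have := Real.pi_pos; positivity) (by nlinarith [Real.pi_pos])
  have hprod : Fsum H m * (w - 1) = w * (w ^ H - 1) := by
    rw [hF, ← geom_sum_mul, ← mul_assoc, Finset.mul_sum]
    congr 1
    rw [Finset.range_eq_Ico, ← Finset.Ico_add_one_right_eq_Icc]
    rw [show (Finset.Ico 1 (H+1)) = (Finset.Ico (0+1) (H+1)) by rfl, ← Finset.sum_Ico_add']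
    refine Finset.sum_congr rfl fun i _ => by ring
  have hn := congrArg norm hprod
  rw [norm_mul, norm_mul, hnorm, hw1, one_mul] at hn
  have h2 : ‖w ^ H - 1‖ ≤ 2 := by
    refine (norm_sub_le _ _).trans ?_
    rw [norm_pow, hw1]; norm_num
  rw [le_div_iff₀ (abs_pos.2 hsinpos.ne')]
  linarith

end fourier


section errsum

variable {q : ℕ} [NeZero q]

lemma harm_bound (Q : ℕ) : ∑ k ∈ Finset.Ico 1 Q, (1 / (k : ℝ)) ≤ 1 + Real.log Q := by
  rcases Nat.eq_zero_or_pos Q with h | h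
  · subst h; simp
  have h1 := harmonic_le_one_add_log (Q - 1)
  have h2 : ((harmonic (Q - 1) : ℚ) : ℝ) = ∑ k ∈ Finset.Ico 1 Q, (1 / (k : ℝ)) := by
    rw [harmonic_eq_sum_Icc]
    push_cast
    have : Finset.Icc 1 (Q - 1) = Finset.Ico 1 Q := by
      ext a; simp only [Finset.mem_Icc, Finset.mem_Ico]; omega
    rw [this]
    simp
  rw [← h2]
  refine h1.trans ?_
  rcases Nat.lt_or_ge 1 Q with h3 | h3
  · gcongr
    · have : 0 < Q - 1 := by omega
      exact_mod_cast this
    · omega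
  · have : Q = 1 := by omega
    subst this; simp

lemma A_bound (H g : ℕ) (hg : g ∣ q) :
    ∑ m ∈ (Finset.univ : Finset (ZMod q)).filter (fun m => m ≠ 0 ∧ g ∣ m.val), ‖Fsum H m‖ ≤
      (q / g : ℝ) * (1 + Real.log q) := by
  have hq : 0 < q := Nat.pos_of_ne_zero (NeZero.ne q)
  obtain ⟨Q, hQ⟩ := hg
  have hg0 : 0 < g := Nat.pos_of_ne_zero (by rintro rfl; simp at hQ; omega)
  have hQ0 : 0 < Q := Nat.pos_of_ne_zero (by rintro rfl; simp at hQ; omega)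
  have hg0' : (0 : ℝ) < g := by exact_mod_cast hg0
  have hQ0' : (0 : ℝ) < Q := by exact_mod_cast hQ0
  have hqr : (q : ℝ) = g * Q := by exact_mod_cast hQ
  calc _ ≤ ∑ m ∈ (Finset.univ : Finset (ZMod q)).filter (fun m => m ≠ 0 ∧ g ∣ m.val),
        (q : ℝ) / 2 * (1 / (m.val : ℝ) + 1 / ((q : ℝ) - m.val)) := by
        apply Finset.sum_le_sum
        intro m hm
        exact Fsum_bound H m (Finset.mem_filter.1 hm).2.1
    _ = ∑ k ∈ Finset.Ico 1 Q, (q : ℝ) / 2 * (1 / ((g * k : ℕ) : ℝ) + 1 / ((q : ℝ) - ((g * k : ℕ) : ℝ))) := by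
        refine Finset.sum_nbij' (fun m => m.val / g) (fun k => ((g * k : ℕ) : ZMod q)) ?_ ?_ ?_ ?_ ?_
        · intro m hm
          simp only [Finset.mem_filter, Finset.mem_univ, true_and, Finset.mem_Ico] at hm ⊢
          have h1 : 0 < m.val := Nat.pos_of_ne_zero (by rw [Ne, ZMod.val_eq_zero]; exact hm.1)
          have h2 := ZMod.val_lt m
          refine ⟨Nat.div_pos (Nat.le_of_dvd h1 hm.2) hg0, ?_⟩
          apply Nat.div_lt_of_lt_mul
          exact lt_of_lt_of_eq h2 hQ
        · intro k hk
          simp only [Finset.mem_filter, Finset.mem_univ, true_and, Finset.mem_Ico] at hk ⊢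
          have hlt : g * k < q := by
            calc g * k < g * Q := Nat.mul_lt_mul_of_pos_left hk.2 hg0
              _ = q := hQ.symm
          refine ⟨?_, ?_⟩
          · rw [Ne, ZMod.natCast_eq_zero_iff]
            intro h
            have := Nat.le_of_dvd (Nat.mul_pos hg0 (by omega)) h
            omega
          · rw [ZMod.val_natCast_of_lt hlt]; exact dvd_mul_right _ _
        · intro m hm
          simp only [Finset.mem_filter, Finset.mem_univ, true_and] at hm
          rw [Nat.mul_div_cancel' hm.2]; exact ZMod.natCast_zmod_val m
        · intro k hk
          simp only [Finset.mem_Ico] at hk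
          have hlt : g * k < q := by
            calc g * k < g * Q := Nat.mul_lt_mul_of_pos_left hk.2 hg0
              _ = q := hQ.symm
          rw [ZMod.val_natCast_of_lt hlt]
          exact Nat.mul_div_cancel_left _ hg0
        · intro m hm
          simp only [Finset.mem_filter, Finset.mem_univ, true_and] at hm
          rw [Nat.mul_div_cancel' hm.2]
    _ = ∑ k ∈ Finset.Ico 1 Q, ((Q : ℝ) / 2 * (1 / (k : ℝ)) + (Q : ℝ) / 2 * (1 / ((Q - k : ℕ) : ℝ))) := by
        refine Finset.sum_congr rfl fun k hk => ?_
        rw [Finset.mem_Ico] at hk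
        rw [Nat.cast_sub hk.2.le]
        have h1 : (0 : ℝ) < k := by exact_mod_cast hk.1
        have h2 : (0 : ℝ) < Q - k := by
          rw [sub_pos]; exact_mod_cast hk.2
        rw [hqr]; push_cast
        rw [show (g * Q - g * k : ℝ) = g * (Q - k) by ring]
        field_simp
    _ = (Q : ℝ) * ∑ k ∈ Finset.Ico 1 Q, (1 / (k : ℝ)) := by
        rw [Finset.sum_add_distrib, ← Finset.mul_sum, ← Finset.mul_sum]
        have : ∑ k ∈ Finset.Ico 1 Q, (1 / ((Q - k : ℕ) : ℝ)) = ∑ k ∈ Finset.Ico 1 Q, (1 / (k : ℝ)) := by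
          refine Finset.sum_nbij' (fun k => Q - k) (fun k => Q - k) ?_ ?_ ?_ ?_ ?_ <;>
          · intro k hk
            simp only [Finset.mem_Ico] at hk ⊢
            try omega
        rw [this]; ring
    _ ≤ (Q : ℝ) * (1 + Real.log Q) := by
        gcongr
        exact harm_bound Q
    _ ≤ _ := by
        have : (q / g : ℝ) = Q := by rw [hqr]; field_simp
        rw [this]
        gcongr
        calc Q ≤ g * Q := Nat.le_mul_of_pos_left _ hg0
          _ = q := hQ.symm

lemma pair_bound (H g : ℕ) (hg : g ∣ q) :
    ∑ z ∈ (Finset.univ : Finset (ZMod q × ZMod q)).filter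
        (fun z => z ≠ 0 ∧ g ∣ z.1.val ∧ g ∣ z.2.val), ‖Fsum H z.1‖ * ‖Fsum H z.2‖ ≤
      2 * H * ((q / g : ℝ) * (1 + Real.log q)) + ((q / g : ℝ) * (1 + Real.log q)) ^ 2 := by
  have hA := A_bound H g hg
  set A := ∑ m ∈ (Finset.univ : Finset (ZMod q)).filter (fun m => m ≠ 0 ∧ g ∣ m.val), ‖Fsum H m‖ with hAdef
  have hA0 : 0 ≤ A := Finset.sum_nonneg fun _ _ => norm_nonneg _
  set S := (Finset.univ : Finset (ZMod q)).filter (fun m => g ∣ m.val) with hS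
  have h0S : (0 : ZMod q) ∈ S := by simp [S]
  have hSA : ∑ m ∈ S, ‖Fsum H m‖ = H + A := by
    rw [← Finset.add_sum_erase _ _ h0S, Fsum_zero]
    congr 1
    apply Finset.sum_congr _ fun _ _ => rfl
    ext m; simp [S]
  have h0 : (0 : ZMod q × ZMod q) ∈ S ×ˢ S := by
    rw [Finset.mem_product]; exact ⟨h0S, h0S⟩
  have h1 : ∑ z ∈ S ×ˢ S, ‖Fsum H z.1‖ * ‖Fsum H z.2‖ = (H + A) * (H + A) := by
    rw [← hSA, Finset.sum_mul_sum, Finset.sum_product]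
  rw [← Finset.add_sum_erase _ _ h0] at h1
  simp only [Prod.fst_zero, Prod.snd_zero, Fsum_zero] at h1
  have h2 : (Finset.univ : Finset (ZMod q × ZMod q)).filter
        (fun z => z ≠ 0 ∧ g ∣ z.1.val ∧ g ∣ z.2.val) = (S ×ˢ S).erase 0 := by
    ext z; simp only [Finset.mem_filter, Finset.mem_univ, true_and, Finset.mem_erase, Finset.mem_product, S]
  rw [h2]
  have h3 : ∑ z ∈ (S ×ˢ S).erase 0, ‖Fsum H z.1‖ * ‖Fsum H z.2‖ = 2 * H * A + A ^ 2 := by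
    linear_combination h1
  rw [h3]
  gcongr

lemma main_error (H d : ℕ) (hd : Squarefree d) (hq : q = d ^ 2) :
    |(q : ℝ) ^ 2 * Nc H q - H ^ 2 * lc q| ≤
      (d.divisors.card : ℝ) ^ 3 * d * (2 * H * q * (1 + Real.log q) + q ^ 2 * (1 + Real.log q) ^ 2) := by
  have hqpos : 0 < q := Nat.pos_of_ne_zero (NeZero.ne q)
  have hd0 : d ≠ 0 := hd.ne_zero
  have hL : 0 ≤ 1 + Real.log q := by
    have := Real.log_natCast_nonneg q
    linarith
  set L := 1 + Real.log q with hLdef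
  have hid := fourier_identity (q := q) H
  rw [← Finset.sum_product', Finset.univ_product_univ,
    ← Finset.add_sum_erase _ _ (Finset.mem_univ (0 : ZMod q × ZMod q))] at hid
  have h00 : Fsum H (0 : ZMod q) * Fsum H (0 : ZMod q) * Esum (0 : ZMod q) 0 = (H : ℂ) ^ 2 * lc q := by
    unfold Fsum Esum
    simp [Tset_card, pow_two]
  simp only [Prod.fst_zero, Prod.snd_zero] at hid
  rw [h00] at hid
  have e1 : |(q : ℝ) ^ 2 * Nc H q - H ^ 2 * lc q| =
      ‖∑ z ∈ (Finset.univ : Finset (ZMod q × ZMod q)).erase 0, Fsum H z.1 * Fsum H z.2 * Esum z.1 z.2‖ := by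
    rw [← Real.norm_eq_abs, ← Complex.norm_real]
    congr 1
    push_cast
    linear_combination hid
  rw [e1]
  have hD : ∀ z : ZMod q × ZMod q, ‖Esum z.1 z.2‖ ≤ (d.divisors.card : ℝ) ^ 2 * d *
      ∑ g ∈ d.divisors, if g ∣ z.1.val ∧ g ∣ z.2.val then (g : ℝ) else 0 := by
    intro z
    refine (Esum_bound d hq z.1 z.2).trans ?_
    have hb := Bc_bound z.1.val z.2.val d hd
    rw [← hq] at hb
    simp only [Int.gcd_natCast_natCast] at hb
    set G := d.gcd (z.1.val.gcd z.2.val) with hG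
    calc (Bc q d z.1.val z.2.val : ℝ) ≤ ((d.divisors.card ^ 2 * d * G : ℕ) : ℝ) := by exact_mod_cast hb
      _ = (d.divisors.card : ℝ) ^ 2 * d * G := by push_cast; ring
      _ ≤ _ := by
        gcongr
        have hmem : G ∈ d.divisors := Nat.mem_divisors.2 ⟨Nat.gcd_dvd_left _ _, hd0⟩
        have hdv : G ∣ z.1.val ∧ G ∣ z.2.val :=
          ⟨(Nat.gcd_dvd_right _ _).trans (Nat.gcd_dvd_left _ _),
            (Nat.gcd_dvd_right _ _).trans (Nat.gcd_dvd_right _ _)⟩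
        have := Finset.single_le_sum (s := d.divisors)
          (f := fun g => if g ∣ z.1.val ∧ g ∣ z.2.val then (g : ℝ) else 0)
          (fun g _ => by split_ifs <;> positivity) hmem
        rw [if_pos hdv] at this
        exact this
  calc _ ≤ ∑ z ∈ (Finset.univ : Finset (ZMod q × ZMod q)).erase 0, ‖Fsum H z.1 * Fsum H z.2 * Esum z.1 z.2‖ :=
        norm_sum_le _ _
    _ ≤ ∑ z ∈ (Finset.univ : Finset (ZMod q × ZMod q)).erase 0, (d.divisors.card : ℝ) ^ 2 * d *
          ∑ g ∈ d.divisors, if g ∣ z.1.val ∧ g ∣ z.2.val then (g : ℝ) * (‖Fsum H z.1‖ * ‖Fsum H z.2‖) else 0 := by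
        apply Finset.sum_le_sum
        intro z _
        rw [norm_mul, norm_mul]
        calc _ ≤ ‖Fsum H z.1‖ * ‖Fsum H z.2‖ * ((d.divisors.card : ℝ) ^ 2 * d *
              ∑ g ∈ d.divisors, if g ∣ z.1.val ∧ g ∣ z.2.val then (g : ℝ) else 0) := by
              gcongr; exact hD z
          _ = _ := by
              rw [mul_left_comm, Finset.mul_sum]
              congr 1
              refine Finset.sum_congr rfl fun g _ => ?_
              split_ifs <;> ring
    _ = (d.divisors.card : ℝ) ^ 2 * d * ∑ g ∈ d.divisors, (g : ℝ) *
          ∑ z ∈ (Finset.univ : Finset (ZMod q × ZMod q)).filter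
          (fun z => z ≠ 0 ∧ g ∣ z.1.val ∧ g ∣ z.2.val), ‖Fsum H z.1‖ * ‖Fsum H z.2‖ := by
        rw [← Finset.mul_sum, Finset.sum_comm]
        congr 1
        refine Finset.sum_congr rfl fun g _ => ?_
        rw [← Finset.sum_filter, Finset.mul_sum]
        apply Finset.sum_congr _ fun _ _ => rfl
        ext z; simp
    _ ≤ (d.divisors.card : ℝ) ^ 2 * d * ∑ g ∈ d.divisors, (2 * H * q * L + q ^ 2 * L ^ 2) := by
        gcongr with g hg
        have hgd := Nat.dvd_of_mem_divisors hg
        have hg0 : 0 < g := Nat.pos_of_mem_divisors hg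
        have hg1 : (1 : ℝ) ≤ g := by exact_mod_cast hg0
        have hgq : g ∣ q := by rw [hq]; exact hgd.trans (dvd_pow_self _ two_ne_zero)
        calc _ ≤ (g : ℝ) * (2 * H * ((q / g : ℝ) * L) + ((q / g : ℝ) * L) ^ 2) := by
              gcongr; exact pair_bound H g hgq
          _ = 2 * H * q * L + q ^ 2 * L ^ 2 / g := by field_simp
          _ ≤ _ := by
              gcongr
              exact div_le_self (by positivity) hg1
    _ = _ := by
        rw [Finset.sum_const, nsmul_eq_mul]; ring

end errsum

lemma err_d (H d : ℕ) (hd : Squarefree d) :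
    |(Nc H (d ^ 2) : ℝ) - H ^ 2 * (lamCount (d ^ 2) / (d : ℝ) ^ 4)| ≤
      (d.divisors.card : ℝ) ^ 3 *
        (2 * H * (1 + 2 * Real.log d) / d + d * (1 + 2 * Real.log d) ^ 2) := by
  have hd0 : d ≠ 0 := hd.ne_zero
  have hdp : (0 : ℝ) < d := by exact_mod_cast Nat.pos_of_ne_zero hd0
  have : NeZero (d ^ 2) := ⟨pow_ne_zero _ hd0⟩
  have h := main_error (q := d ^ 2) H d hd rfl
  rw [lc_eq_lamCount _ (pow_pos (Nat.pos_of_ne_zero hd0) 2)]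
  push_cast at h
  rw [Real.log_pow] at h
  push_cast at h
  have e : (Nc H (d ^ 2) : ℝ) - H ^ 2 * (lc (d ^ 2) / (d : ℝ) ^ 4) =
      (((d : ℝ) ^ 2) ^ 2 * Nc H (d ^ 2) - H ^ 2 * lc (d ^ 2)) / d ^ 4 := by
    field_simp
  rw [e, abs_div, abs_of_pos (pow_pos hdp 4), div_le_iff₀ (pow_pos hdp 4)]
  refine h.trans (le_of_eq ?_)
  field_simp

lemma lam_bound (d : ℕ) (hd : Squarefree d) :
    (lamCount (d ^ 2) : ℝ) / (d : ℝ) ^ 4 ≤ (d.divisors.card : ℝ) ^ 2 / (d : ℝ) ^ 2 := by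
  have hd0 : d ≠ 0 := hd.ne_zero
  have hdp : (0 : ℝ) < d := by exact_mod_cast Nat.pos_of_ne_zero hd0
  have h := Bc_bound 0 0 d hd
  have h1 : Bc (d ^ 2) d 0 0 = lamCount (d ^ 2) := by
    rw [lc_eq_lamCount _ (pow_pos (Nat.pos_of_ne_zero hd0) 2)]
    unfold Bc lc
    simp
  rw [h1] at h
  simp only [Int.gcd_self, Int.natAbs_zero, Nat.cast_zero, Int.gcd_zero_right, Int.natAbs_natCast] at h
  have h2 : (lamCount (d ^ 2) : ℝ) ≤ (d.divisors.card : ℝ) ^ 2 * d * d := by exact_mod_cast h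
  rw [div_le_div_iff₀ (by positivity) (by positivity)]
  calc _ ≤ (d.divisors.card : ℝ) ^ 2 * d * d * d ^ 2 := by gcongr
    _ = _ := by ring


lemma sq_dvd_aux (d b a : ℕ) (ha : Squarefree a) (hb : 0 < b) : d ^ 2 ∣ b ^ 2 * a ↔ d ∣ b := by
  constructor
  · intro h
    have hg : 0 < Nat.gcd d b := Nat.gcd_pos_of_pos_right _ hb
    obtain ⟨g, d', b', hg0, hc, hd, hb'⟩ := Nat.exists_coprime' hg
    subst hd hb'
    have h1 : d' ^ 2 ∣ b' ^ 2 * a := by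
      have : (d' ^ 2) * g ^ 2 ∣ (b' ^ 2 * a) * g ^ 2 := by
        convert h using 1 <;> ring
      exact Nat.dvd_of_mul_dvd_mul_right (pow_pos hg0 2) this
    have h2 : d' ^ 2 ∣ a := (Nat.Coprime.pow 2 2 hc).dvd_of_dvd_mul_left h1
    rw [pow_two] at h2
    have h3 := Nat.isUnit_iff.1 (ha d' h2)
    rw [h3, one_mul]; exact dvd_mul_left _ _
  · intro h
    exact (pow_dvd_pow_of_dvd h 2).mul_right a

lemma sqfree_sum (n D : ℕ) (hn : 0 < n) (hD : ∀ d, d ^ 2 ∣ n → d ≤ D) :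
    ∑ d ∈ Finset.range (D + 1), (if d ^ 2 ∣ n then ArithmeticFunction.moebius d else 0) =
      if Squarefree n then 1 else 0 := by
  obtain ⟨a, b, hab, ha⟩ := Nat.sq_mul_squarefree n
  have hb : 0 < b := Nat.pos_of_ne_zero (by rintro rfl; simp at hab; omega)
  have hiff : ∀ d, d ^ 2 ∣ n ↔ d ∣ b := fun d => by rw [← hab]; exact sq_dvd_aux d b a ha hb
  rw [← Finset.sum_filter]
  have hset : (Finset.range (D + 1)).filter (fun d => d ^ 2 ∣ n) = b.divisors := by
    ext d
    rw [Finset.mem_filter, Finset.mem_range, Nat.mem_divisors, ← hiff]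
    constructor
    · rintro ⟨-, h⟩; exact ⟨h, hb.ne'⟩
    · rintro ⟨h, -⟩; exact ⟨by have := hD d h; omega, h⟩
  rw [hset, ← ArithmeticFunction.coe_mul_zeta_apply, ArithmeticFunction.moebius_mul_coe_zeta,
    ArithmeticFunction.one_apply]
  congr 1
  apply propext
  constructor
  · rintro rfl; rw [one_pow, one_mul] at hab; rwa [← hab]
  · intro h
    exact Nat.isUnit_iff.1 (h b (by rw [← hab, ← pow_two]; exact dvd_mul_right _ _))

lemma Scount_eq (H : ℕ) :
    (Scount H : ℝ) = ∑ d ∈ Finset.range (2 * H + 1), (ArithmeticFunction.moebius d : ℝ) * Nc H (d ^ 2) := by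
  have key : (Scount H : ℤ) = ∑ d ∈ Finset.range (2 * H + 1), ArithmeticFunction.moebius d * (Nc H (d ^ 2) : ℤ) := by
    unfold Scount Nc
    simp only [Finset.card_filter]
    push_cast
    simp_rw [Finset.mul_sum]
    rw [Finset.sum_comm]
    refine Finset.sum_congr rfl fun z hz => ?_
    simp only [Finset.mem_product, Finset.mem_Icc] at hz
    rw [← sqfree_sum _ (2 * H) (by positivity)]
    · refine Finset.sum_congr rfl fun d _ => ?_
      split_ifs <;> simp
    · intro d hd
      have h1 := Nat.le_of_dvd (by positivity) hd
      by_contra h2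
      have h3 : z.1 ^ 2 ≤ H ^ 2 := Nat.pow_le_pow_left hz.1.2 2
      have h4 : z.2 ^ 2 ≤ H ^ 2 := Nat.pow_le_pow_left hz.2.2 2
      nlinarith
  have := congrArg (fun t : ℤ => (t : ℝ)) key
  push_cast at this
  exact this

lemma Nc_tail (H d : ℕ) (hH : 0 < H) (hd : 2 ≤ d) (B : ℝ) (hB0 : 0 ≤ B)
    (hB : ∀ n : ℕ, 0 < n → n ≤ 3 * H ^ 2 → ((r2 n).card : ℝ) ≤ B) :
    (Nc H (d ^ 2) : ℝ) ≤ 3 * H ^ 2 / (d : ℝ) ^ 2 * B := by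
  classical
  have hd2 : 4 ≤ d ^ 2 := by nlinarith
  have hsub : ((Finset.Icc 1 H ×ˢ Finset.Icc 1 H).filter
      (fun p : ℕ × ℕ => d ^ 2 ∣ p.1 ^ 2 + p.2 ^ 2 + 1)) ⊆
      (Finset.Icc 1 (3 * H ^ 2 / d ^ 2)).biUnion (fun k => r2 (d ^ 2 * k - 1)) := by
    intro z hz
    simp only [Finset.mem_filter, Finset.mem_product, Finset.mem_Icc] at hz
    obtain ⟨⟨⟨h1, h2⟩, h3, h4⟩, k, hk⟩ := hz
    have h5 : z.1 ^ 2 ≤ H ^ 2 := Nat.pow_le_pow_left h2 2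
    have h6 : z.2 ^ 2 ≤ H ^ 2 := Nat.pow_le_pow_left h4 2
    have h7 : 1 ≤ H ^ 2 := Nat.one_le_pow _ _ hH
    rw [Finset.mem_biUnion]
    refine ⟨k, ?_, ?_⟩
    · rw [Finset.mem_Icc]
      refine ⟨Nat.pos_of_ne_zero ?_, ?_⟩
      · rintro rfl; simp at hk
      · rw [Nat.le_div_iff_mul_le (by omega), mul_comm, ← hk]; omega
    · rw [mem_r2]; exact ⟨h1, h3, by omega⟩
  unfold Nc
  calc _ ≤ ((∑ k ∈ Finset.Icc 1 (3 * H ^ 2 / d ^ 2), (r2 (d ^ 2 * k - 1)).card : ℕ) : ℝ) := by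
        exact_mod_cast (Finset.card_le_card hsub).trans Finset.card_biUnion_le
    _ = ∑ k ∈ Finset.Icc 1 (3 * H ^ 2 / d ^ 2), ((r2 (d ^ 2 * k - 1)).card : ℝ) := by push_cast; rfl
    _ ≤ ∑ k ∈ Finset.Icc 1 (3 * H ^ 2 / d ^ 2), B := by
        apply Finset.sum_le_sum
        intro k hk
        rw [Finset.mem_Icc] at hk
        have h1 : d ^ 2 * k ≤ 3 * H ^ 2 := by
          have := (Nat.le_div_iff_mul_le (by omega)).1 hk.2
          linarith
        have h2 : 4 ≤ d ^ 2 * k := by nlinarith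
        exact hB _ (by omega) (by omega)
    _ = ((3 * H ^ 2 / d ^ 2 : ℕ) : ℝ) * B := by simp
    _ ≤ _ := by
        gcongr
        refine Nat.cast_div_le.trans ?_
        push_cast; rfl

/-- the coefficients of the main term -/
noncomputable def fco (d : ℕ) : ℝ :=
  (ArithmeticFunction.moebius d : ℝ) * (lamCount (d ^ 2) / (d : ℝ) ^ 4)

lemma fco_abs (d : ℕ) (hd : Squarefree d) : |fco d| ≤ (d.divisors.card : ℝ) ^ 2 / (d : ℝ) ^ 2 := by
  unfold fco
  rw [abs_mul, abs_of_nonneg (show (0 : ℝ) ≤ lamCount (d ^ 2) / (d : ℝ) ^ 4 by positivity)]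
  have h1 : |(ArithmeticFunction.moebius d : ℝ)| = 1 := by
    exact_mod_cast ArithmeticFunction.abs_moebius_eq_one_of_squarefree hd
  rw [h1, one_mul]
  exact lam_bound d hd

lemma fco_nsq (d : ℕ) (hd : ¬ Squarefree d) : fco d = 0 := by
  unfold fco
  rw [ArithmeticFunction.moebius_eq_zero_of_not_squarefree hd]; simp

lemma fco_euler (hs : Summable fco) :
    ∏' p : Nat.Primes, (1 - (lamCount ((p : ℕ)^2) : ℝ) / (p : ℕ)^4) = ∑' d, fco d := by
  have h1 : fco 1 = 1 := by
    unfold fco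
    rw [one_pow, lc_eq_lamCount 1 one_pos]
    have : lc 1 = 1 := by
      unfold lc
      have : Subsingleton (ZMod 1) := inferInstance
      rw [Nat.card_eq_one_iff_unique]
      exact ⟨inferInstance, ⟨⟨0, Subsingleton.elim _ _⟩⟩⟩
    rw [this]; simp
  have hmul : ∀ {m n : ℕ}, m.Coprime n → fco (m * n) = fco m * fco n := by
    intro m n hmn
    rcases Nat.eq_zero_or_pos m with rfl | hm
    · unfold fco; simp
    rcases Nat.eq_zero_or_pos n with rfl | hn
    · unfold fco; simp
    unfold fco
    rw [ArithmeticFunction.isMultiplicative_moebius.map_mul_of_coprime hmn,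
      lc_eq_lamCount _ (by positivity), lc_eq_lamCount _ (by positivity),
      lc_eq_lamCount _ (by positivity), mul_pow, lc_mul _ _ (Nat.Coprime.pow 2 2 hmn)]
    push_cast
    field_simp
  rw [← EulerProduct.eulerProduct_tprod h1 hmul hs.norm (by unfold fco; simp)]
  congr 1
  ext p
  rw [tsum_eq_sum (s := Finset.range 2)]
  · rw [Finset.sum_range_succ, Finset.sum_range_one, pow_zero, pow_one, h1]
    unfold fco
    rw [ArithmeticFunction.moebius_apply_prime p.2]
    push_cast; ring
  · intro e he
    rw [Finset.mem_range, not_lt] at he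
    apply fco_nsq
    intro h
    have := (Nat.squarefree_pow_iff p.2.one_lt.ne' (by omega)).1 h
    omega


theorem main_bound_s18 (δ : ℝ) (hδ : 0 < δ) (hδ1 : δ ≤ 1 / 5) : ∃ C : ℝ, 0 < C ∧
    ∀ H : ℕ, 0 < H →
      |(Scount H : ℝ) -
          (∏' p : Nat.Primes, (1 - (lamCount ((p : ℕ)^2) : ℝ) / (p : ℕ)^4)) * H^2| ≤
        C * (H : ℝ) ^ (4/3 + 6 * δ : ℝ) := by
  obtain ⟨C, hC1, hC⟩ := divisor_bound_s18 δ hδ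
  have hC0 : 0 < C := by linarith
  set w : ℕ → ℝ := fun d => (d : ℝ) ^ (-1 - δ) with hw
  have hw0 : ∀ d, 0 ≤ w d := fun d => by positivity
  have hws : Summable w := Real.summable_nat_rpow.2 (by linarith)
  set Z := ∑' d, w d with hZ
  have hZ0 : 0 ≤ Z := tsum_nonneg hw0
  have hwsum : ∀ s : Finset ℕ, ∑ d ∈ s, w d ≤ Z := fun s => hws.sum_le_tsum s fun d _ => hw0 d
  -- pointwise bound for fco
  have hf1 : ∀ d : ℕ, 0 < d → |fco d| ≤ C ^ 2 * (w d * (d : ℝ) ^ (-1 + 3 * δ)) := by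
    intro d hd
    have hd' : (0 : ℝ) < d := by exact_mod_cast hd
    by_cases hsq : Squarefree d
    · refine (fco_abs d hsq).trans ?_
      calc _ ≤ (C * (d : ℝ) ^ δ) ^ 2 / (d : ℝ) ^ 2 := by gcongr; exact hC d hd
        _ = _ := by
          have e1 : w d * (d : ℝ) ^ (-1 + 3 * δ) = ((d : ℝ) ^ δ) ^ 2 / (d : ℝ) ^ 2 := by
            rw [hw]; simp only
            rw [← Real.rpow_add hd', ← Real.rpow_natCast ((d : ℝ) ^ δ), ← Real.rpow_mul hd'.le,
              ← Real.rpow_natCast (d : ℝ), ← Real.rpow_sub hd']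
            congr 1; push_cast; ring
          rw [e1]; ring
    · rw [fco_nsq d hsq, abs_zero]; have := hw0 d; positivity
  have hfs : Summable fco := by
    apply Summable.of_norm_bounded (g := fun d => C ^ 2 * w d) (hws.mul_left _)
    intro d
    rcases Nat.eq_zero_or_pos d with rfl | hd
    · unfold fco
      simp only [ArithmeticFunction.map_zero, Int.cast_zero, zero_mul, norm_zero]
      have := hw0 0; positivity
    · rw [Real.norm_eq_abs]
      refine (hf1 d hd).trans ?_
      have h1 : (d : ℝ) ^ (-1 + 3 * δ) ≤ 1 :=
        Real.rpow_le_one_of_one_le_of_nonpos (by exact_mod_cast hd) (by linarith)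
      have := hw0 d
      have : w d * (d : ℝ) ^ (-1 + 3 * δ) ≤ w d * 1 := by gcongr
      rw [mul_one] at this
      gcongr
  rw [fco_euler hfs]
  set K := 1 + 2 / δ with hK
  have hK0 : 0 < K := by positivity
  refine ⟨8 * C ^ 3 * (2 * K * Z + K ^ 2) + 27 * C ^ 2 * Z + C ^ 2 * Z, by positivity, ?_⟩
  intro H hH
  have hH1 : (1 : ℝ) ≤ H := by exact_mod_cast hH
  have hH0 : (0 : ℝ) < H := by linarith
  set U := (H : ℝ) ^ δ with hU
  have hU1 : 1 ≤ U := Real.one_le_rpow hH1 hδ.le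
  have hU0 : 0 < U := by linarith
  set y := (H : ℝ) ^ (2 / 3 : ℝ) with hy
  have hy1 : 1 ≤ y := Real.one_le_rpow hH1 (by norm_num)
  have hy0 : 0 < y := by linarith
  set z := ⌊y⌋₊ with hz
  have hzy : (z : ℝ) ≤ y := Nat.floor_le hy0.le
  have hz1 : 1 ≤ z := by rw [hz, Nat.one_le_floor_iff]; exact hy1
  have hyH : y ≤ H := by
    calc y ≤ (H : ℝ) ^ (1 : ℝ) := Real.rpow_le_rpow_of_exponent_le hH1 (by norm_num)
      _ = H := Real.rpow_one _
  have hzH : z ≤ H := by exact_mod_cast hzy.trans hyH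
  set X := (H : ℝ) ^ (4 / 3 : ℝ) with hX
  have hX0 : 0 < X := by positivity
  have hyX : y * y = X := by
    rw [hy, hX, ← Real.rpow_add hH0]; norm_num
  have hHX : (H : ℝ) ≤ X := by
    calc (H : ℝ) = (H : ℝ) ^ (1 : ℝ) := (Real.rpow_one _).symm
      _ ≤ _ := Real.rpow_le_rpow_of_exponent_le hH1 (by norm_num)
  have hHyX : (H : ℝ) ^ 2 * y⁻¹ = X := by
    rw [hy, hX, ← Real.rpow_neg hH0.le, ← Real.rpow_natCast, ← Real.rpow_add hH0]; norm_num
  have hfinal : (H : ℝ) ^ (4 / 3 + 6 * δ : ℝ) = X * U ^ 6 := by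
    rw [hX, hU, Real.rpow_add hH0, ← Real.rpow_natCast, ← Real.rpow_mul hH0.le]
    congr 2; push_cast; ring
  rw [hfinal]
  -- large d
  have hlarge : ∀ d : ℕ, z + 1 ≤ d → y ≤ d := by
    intro d hd
    have := Nat.lt_floor_add_one y
    have h2 : ((z + 1 : ℕ) : ℝ) ≤ d := by exact_mod_cast hd
    push_cast at h2
    linarith
  have hypow : ∀ (d : ℕ) (k : ℝ), z + 1 ≤ d → 0 ≤ k → k ≤ 3 → (d : ℝ) ^ (-1 + k * δ) ≤ y⁻¹ * U ^ 2 := by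
    intro d k hd hk0 hk3
    calc (d : ℝ) ^ (-1 + k * δ) ≤ y ^ (-1 + k * δ) :=
          Real.rpow_le_rpow_of_nonpos hy0 (hlarge d hd) (by nlinarith)
      _ ≤ y ^ (-1 + 3 * δ) := Real.rpow_le_rpow_of_exponent_le hy1 (by nlinarith)
      _ = _ := by
        rw [Real.rpow_add hy0, Real.rpow_neg_one]
        congr 1
        rw [hy, hU, ← Real.rpow_mul hH0.le, ← Real.rpow_natCast, ← Real.rpow_mul hH0.le]
        congr 1; push_cast; ring
  have hmu : ∀ d : ℕ, |(ArithmeticFunction.moebius d : ℝ)| ≤ 1 := fun d => by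
    exact_mod_cast ArithmeticFunction.abs_moebius_le_one
  -- small d
  have hsmall : ∀ d ∈ Finset.range (z + 1),
      |(ArithmeticFunction.moebius d : ℝ) * Nc H (d ^ 2) - fco d * H ^ 2| ≤
        8 * C ^ 3 * (2 * H * K * U ^ 6 * w d) + 8 * C ^ 3 * (K ^ 2 * U ^ 6 * (if d = 0 then 0 else y)) := by
    intro d hd
    rw [Finset.mem_range] at hd
    have hwd := hw0 d
    by_cases hsq : Squarefree d
    · have hd0 : 0 < d := Nat.pos_of_ne_zero hsq.ne_zero
      have hd' : (0 : ℝ) < d := by exact_mod_cast hd0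
      have hd1 : (1 : ℝ) ≤ d := by exact_mod_cast hd0
      have hdH : (d : ℝ) ≤ H := by exact_mod_cast (show d ≤ H by omega)
      have hdy : (d : ℝ) ≤ y := le_trans (by exact_mod_cast (show d ≤ z by omega)) hzy
      have hdU : (d : ℝ) ^ δ ≤ U := Real.rpow_le_rpow hd'.le hdH hδ.le
      have hlog : 1 + 2 * Real.log d ≤ K * U := by
        have h1 := Real.log_le_rpow_div hd'.le hδ
        have h2 : (d : ℝ) ^ δ / δ ≤ U / δ := by gcongr
        have h3 : K * U = U + 2 * (U / δ) := by rw [hK]; ring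
        rw [h3]; linarith
      have hlog0 : 0 ≤ 1 + 2 * Real.log d := by
        have := Real.log_nonneg hd1
        linarith
      have htau : (d.divisors.card : ℝ) ≤ C * U := (hC d hd0).trans (by gcongr)
      have hinv : 1 / (d : ℝ) ≤ w d * U := by
        have : 1 / (d : ℝ) = w d * (d : ℝ) ^ δ := by
          rw [hw]; simp only
          rw [← Real.rpow_add hd', show -1 - δ + δ = -1 by ring, Real.rpow_neg_one, one_div]
        rw [this]; gcongr
      have e : (ArithmeticFunction.moebius d : ℝ) * Nc H (d ^ 2) - fco d * H ^ 2 =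
          (ArithmeticFunction.moebius d : ℝ) *
            ((Nc H (d ^ 2) : ℝ) - H ^ 2 * (lamCount (d ^ 2) / (d : ℝ) ^ 4)) := by
        unfold fco; ring
      rw [e, abs_mul, if_neg hd0.ne']
      calc _ ≤ 1 * ((d.divisors.card : ℝ) ^ 3 *
            (2 * H * (1 + 2 * Real.log d) / d + d * (1 + 2 * Real.log d) ^ 2)) := by
            gcongr
            · exact hmu d
            · exact err_d H d hsq
        _ = (d.divisors.card : ℝ) ^ 3 *
            (2 * H * (1 + 2 * Real.log d) * (1 / d) + d * (1 + 2 * Real.log d) ^ 2) := by ring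
        _ ≤ (C * U) ^ 3 * (2 * H * (K * U) * (w d * U) + y * (K * U) ^ 2) := by gcongr
        _ = 1 * C ^ 3 * (2 * H * K * U ^ 5 * w d) + 1 * C ^ 3 * (K ^ 2 * U ^ 5 * y) := by ring
        _ ≤ _ := by gcongr <;> first | exact hU1 | norm_num
    · rw [fco_nsq d hsq, ArithmeticFunction.moebius_eq_zero_of_not_squarefree hsq]
      simp only [Int.cast_zero, zero_mul, sub_zero, abs_zero]
      split_ifs <;> positivity
  have hT1 : |∑ d ∈ Finset.range (z + 1), ((ArithmeticFunction.moebius d : ℝ) * Nc H (d ^ 2) - fco d * H ^ 2)|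
      ≤ 8 * C ^ 3 * (2 * K * Z + K ^ 2) * (X * U ^ 6) := by
    refine (Finset.abs_sum_le_sum_abs _ _).trans ((Finset.sum_le_sum hsmall).trans ?_)
    rw [Finset.sum_add_distrib, ← Finset.mul_sum, ← Finset.mul_sum, ← Finset.mul_sum, ← Finset.mul_sum]
    have h2 : ∑ d ∈ Finset.range (z + 1), (if d = 0 then 0 else y) ≤ X := by
      rw [Finset.sum_range_succ', if_pos rfl, add_zero]
      simp only [Nat.succ_ne_zero, if_false]
      rw [Finset.sum_const, Finset.card_range, nsmul_eq_mul, ← hyX]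
      gcongr
    calc _ ≤ 8 * C ^ 3 * (2 * X * K * U ^ 6 * Z) + 8 * C ^ 3 * (K ^ 2 * U ^ 6 * X) := by
          gcongr
          exact hwsum _
      _ = _ := by ring
  have hT2 : |∑ d ∈ Finset.Ico (z + 1) (2 * H + 1), (ArithmeticFunction.moebius d : ℝ) * Nc H (d ^ 2)|
      ≤ 27 * C ^ 2 * Z * (X * U ^ 6) := by
    have hr : ∀ n : ℕ, 0 < n → n ≤ 3 * H ^ 2 → ((r2 n).card : ℝ) ≤ (C * (n : ℝ) ^ δ) ^ 2 := by
      intro n hn _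
      calc ((r2 n).card : ℝ) ≤ (n.divisors.card : ℝ) ^ 2 := by exact_mod_cast r2_le n hn
        _ ≤ _ := by gcongr; exact hC n hn
    have hr2 : ∀ n : ℕ, 0 < n → n ≤ 3 * H ^ 2 → ((r2 n).card : ℝ) ≤ 9 * C ^ 2 * U ^ 4 := by
      intro n hn hn3
      refine (hr n hn hn3).trans ?_
      have h1 : (n : ℝ) ≤ 3 * (H : ℝ) ^ 2 := by exact_mod_cast hn3
      have h2 : (n : ℝ) ^ δ ≤ 3 * U ^ 2 := by
        calc (n : ℝ) ^ δ ≤ (3 * (H : ℝ) ^ 2) ^ δ := by gcongr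
          _ = 3 ^ δ * ((H : ℝ) ^ 2) ^ δ := Real.mul_rpow (by norm_num) (by positivity)
          _ = 3 ^ δ * U ^ 2 := by
              rw [hU, ← Real.rpow_natCast, ← Real.rpow_natCast, ← Real.rpow_mul hH0.le,
                ← Real.rpow_mul hH0.le, mul_comm δ]
          _ ≤ 3 ^ (1 : ℝ) * U ^ 2 := by
              gcongr
              · norm_num
              · linarith
          _ = _ := by rw [Real.rpow_one]
      calc (C * (n : ℝ) ^ δ) ^ 2 ≤ (C * (3 * U ^ 2)) ^ 2 := by gcongr
        _ = _ := by ring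
    have hterm : ∀ d ∈ Finset.Ico (z + 1) (2 * H + 1),
        |(ArithmeticFunction.moebius d : ℝ) * Nc H (d ^ 2)| ≤ 27 * C ^ 2 * (X * U ^ 6) * w d := by
      intro d hd
      rw [Finset.mem_Ico] at hd
      have hd' : (0 : ℝ) < d := by exact_mod_cast (show 0 < d by omega)
      have hwd := hw0 d
      rw [abs_mul, abs_of_nonneg (Nat.cast_nonneg (Nc H (d ^ 2)) : (0 : ℝ) ≤ _)]
      have h1 := Nc_tail H d hH (by omega) (9 * C ^ 2 * U ^ 4) (by positivity) hr2
      have h2 : 1 / (d : ℝ) ^ 2 = w d * (d : ℝ) ^ (-1 + 1 * δ) := by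
        rw [hw]; simp only
        rw [← Real.rpow_add hd', show -1 - δ + (-1 + 1 * δ) = -2 by ring, Real.rpow_neg hd'.le, one_div]
        norm_num
      have h3 := hypow d 1 hd.1 (by norm_num) (by norm_num)
      calc _ ≤ 1 * (3 * H ^ 2 / (d : ℝ) ^ 2 * (9 * C ^ 2 * U ^ 4)) := by
            gcongr
            exact hmu d
        _ = 27 * C ^ 2 * U ^ 4 * H ^ 2 * (1 / (d : ℝ) ^ 2) := by ring
        _ ≤ 27 * C ^ 2 * U ^ 4 * H ^ 2 * (w d * (y⁻¹ * U ^ 2)) := by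
            rw [h2]; gcongr
        _ = 27 * C ^ 2 * ((H ^ 2 * y⁻¹) * U ^ 6) * w d := by ring
        _ = _ := by rw [hHyX]
    refine (Finset.abs_sum_le_sum_abs _ _).trans ((Finset.sum_le_sum hterm).trans ?_)
    rw [← Finset.mul_sum]
    calc _ ≤ 27 * C ^ 2 * (X * U ^ 6) * Z := by gcongr; exact hwsum _
      _ = _ := by ring
  have hT3 : |(∑' d, fco (d + (z + 1))) * (H : ℝ) ^ 2| ≤ C ^ 2 * Z * (X * U ^ 6) := by
    have hs2 : Summable (fun d => w (d + (z + 1))) := (summable_nat_add_iff (z + 1)).2 hws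
    have hb : ∀ d : ℕ, ‖fco (d + (z + 1))‖ ≤ C ^ 2 * (y⁻¹ * U ^ 2) * w (d + (z + 1)) := by
      intro d
      rw [Real.norm_eq_abs]
      refine (hf1 _ (by omega)).trans ?_
      have h1 := hypow (d + (z + 1)) 3 (by omega) (by norm_num) le_rfl
      have h2 := hw0 (d + (z + 1))
      calc _ ≤ C ^ 2 * (w (d + (z + 1)) * (y⁻¹ * U ^ 2)) := by gcongr
        _ = _ := by ring
    have h1 := tsum_of_norm_bounded (hs2.mul_left (C ^ 2 * (y⁻¹ * U ^ 2))).hasSum hb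
    rw [tsum_mul_left] at h1
    have h2 : ∑' d, w (d + (z + 1)) ≤ Z := by
      have := hws.sum_add_tsum_nat_add (z + 1)
      have h3 : 0 ≤ ∑ d ∈ Finset.range (z + 1), w d := Finset.sum_nonneg fun d _ => hw0 d
      linarith
    rw [abs_mul, ← Real.norm_eq_abs, abs_of_nonneg (by positivity : (0 : ℝ) ≤ (H : ℝ) ^ 2)]
    calc _ ≤ C ^ 2 * (y⁻¹ * U ^ 2) * Z * (H : ℝ) ^ 2 := by
          gcongr
          exact h1.trans (by gcongr)
      _ = C ^ 2 * Z * (X * U ^ 2) := by rw [← hHyX]; ring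
      _ ≤ _ := by
          gcongr
          norm_num
  rw [Scount_eq, ← Finset.sum_range_add_sum_Ico _ (show z + 1 ≤ 2 * H + 1 by omega),
    ← hfs.sum_add_tsum_nat_add (z + 1)]
  rw [Finset.sum_sub_distrib, ← Finset.sum_mul] at hT1
  set s1 := ∑ d ∈ Finset.range (z + 1), (ArithmeticFunction.moebius d : ℝ) * Nc H (d ^ 2)
  set s2 := ∑ d ∈ Finset.Ico (z + 1) (2 * H + 1), (ArithmeticFunction.moebius d : ℝ) * Nc H (d ^ 2)
  set s3 := ∑ d ∈ Finset.range (z + 1), fco d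
  set s4 := ∑' d, fco (d + (z + 1))
  calc |s1 + s2 - (s3 + s4) * (H : ℝ) ^ 2| = |(s1 - s3 * (H : ℝ) ^ 2) + s2 - s4 * (H : ℝ) ^ 2| := by
        congr 1; ring
    _ ≤ |s1 - s3 * (H : ℝ) ^ 2| + |s2| + |s4 * (H : ℝ) ^ 2| :=
        (abs_sub _ _).trans (by gcongr; exact abs_add_le _ _)
    _ ≤ _ := by linarith

theorem stmt_18 : ∀ ε : ℝ, 0 < ε → ∃ C : ℝ, 0 < C ∧
    ∀ H : ℕ, 0 < H →
      |(Scount H : ℝ) -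
          (∏' p : Nat.Primes, (1 - (lamCount ((p : ℕ)^2) : ℝ) / (p : ℕ)^4)) * H^2| ≤
        C * (H : ℝ) ^ (4/3 + ε : ℝ) := by
  intro ε hε
  obtain ⟨C, hC, h⟩ := main_bound_s18 (min ε 1 / 6) (by positivity)
    (by have := min_le_right ε 1; linarith)
  refine ⟨C, hC, fun H hH => (h H hH).trans ?_⟩
  have hH1 : (1 : ℝ) ≤ H := by exact_mod_cast hH
  gcongr
  have := min_le_left ε 1
  linarith
end
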